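/- arXiv:2305.03146 — 2 statements merged into one kernel-verified Lean document; each statement's English description precedes it below -/
import Mathlib

section
/- Let K ⊆ ℝⁿ be a convex set (not necessarily symmetric) with vol(K) > 0, and let D = N(0,I_n)|K. Then Var_{x ∼ D}[‖x‖²] ≤ 4 · E_{x ∼ D}[‖x‖²]. -/
open MeasureTheory ProbabilityTheory Real

/-- The standard Gaussian measure `N(0, I_n)` on `ℝⁿ`. -/
noncomputable def stdGaussian (n : ℕ) : Measure (EuclideanSpace ℝ (Fin n)) :=
  volume.withDensity fun x =>
    ENNReal.ofReal ((2 * π) ^ (-(n : ℝ) / 2) * Real.exp (-‖x‖ ^ 2 / 2))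

/-- The standard Gaussian measure conditioned on the set `K`. -/
noncomputable def truncGaussian (n : ℕ) (K : Set (EuclideanSpace ℝ (Fin n))) :
    Measure (EuclideanSpace ℝ (Fin n)) :=
  (stdGaussian n K)⁻¹ • (stdGaussian n).restrict K

lemma bm_compact {A B C : Set ℝ} (hA : IsCompact A) (hB : IsCompact B) (hAn : A.Nonempty)
    (hBn : B.Nonempty)
    (h : ∀ x ∈ A, ∀ y ∈ B, ∀ z, z + z = x + y → z ∈ C) :
    volume A + volume B ≤ 2 * volume C := by
  obtain ⟨a, ha, ha'⟩ := hA.exists_isGreatest hAn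
  obtain ⟨b, hb, hb'⟩ := hB.exists_isLeast hBn
  have e1 : volume ((fun x => x * (1/2 : ℝ)) ⁻¹' C) = 2 * volume C := by
    rw [Real.volume_preimage_mul_right (by norm_num)]
    norm_num
  have m1 : volume ((fun x => x + (-b)) ⁻¹' A) = volume A := measure_preimage_add_right _ _ _
  have m2 : volume ((fun x => x + (-a)) ⁻¹' B) = volume B := measure_preimage_add_right _ _ _
  rw [← e1, ← m1, ← m2, ← measure_union₀]
  · apply measure_mono
    rintro x (hx | hx)
    · exact h _ hx b hb _ (by ring)
    · exact h a ha _ hx _ (by ring)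
  · exact (hB.measurableSet.preimage (by fun_prop)).nullMeasurableSet
  · have : ((fun x => x + (-b)) ⁻¹' A) ∩ ((fun x => x + (-a)) ⁻¹' B) ⊆ {a + b} := by
      rintro x ⟨hx1, hx2⟩
      have := ha' hx1
      have := hb' hx2
      simp only [Set.mem_singleton_iff] at *
      linarith
    exact measure_mono_null this (by simp)

lemma bm {A B C : Set ℝ} (hA : MeasurableSet A) (hB : MeasurableSet B) (hAn : A.Nonempty)
    (hBn : B.Nonempty)
    (h : ∀ x ∈ A, ∀ y ∈ B, ∀ z, z + z = x + y → z ∈ C) :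
    volume A + volume B ≤ 2 * volume C := by
  obtain ⟨a, ha⟩ := hAn
  obtain ⟨b, hb⟩ := hBn
  rw [hA.measure_eq_iSup_isCompact, hB.measure_eq_iSup_isCompact]
  simp only [iSup_and']
  refine ENNReal.biSup_add_biSup_le' (p := fun K => K ⊆ A ∧ IsCompact K)
    (q := fun K => K ⊆ B ∧ IsCompact K) ⟨∅, by simp⟩ ⟨∅, by simp⟩ ?_
  rintro K ⟨hK, hKc⟩ L ⟨hL, hLc⟩
  refine le_trans (add_le_add (measure_mono (Set.subset_insert a K))
    (measure_mono (Set.subset_insert b L)))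
    (bm_compact (hKc.insert a) (hLc.insert b) (Set.insert_nonempty _ _)
    (Set.insert_nonempty _ _) ?_)
  intro x hx y hy
  exact h x (Set.insert_subset ha hK hx) y (Set.insert_subset hb hL hy)

lemma pl_norm {f g h : ℝ → ℝ} (hf : Measurable f) (hg : Measurable g) (hh : Measurable h)
    (f0 : ∀ x, 0 ≤ f x) (g0 : ∀ x, 0 ≤ g x) (h0 : ∀ x, 0 ≤ h x)
    (f1 : ∀ x, f x ≤ 1) (g1 : ∀ x, g x ≤ 1)
    (f2 : ∀ t < 1, ∃ x, t < f x) (g2 : ∀ t < 1, ∃ x, t < g x)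
    (H : ∀ x y z, z + z = x + y → f x * g y ≤ h z ^ 2) :
    (∫⁻ x, ENNReal.ofReal (f x)) + ∫⁻ x, ENNReal.ofReal (g x) ≤ 2 * ∫⁻ x, ENNReal.ofReal (h x) := by
  rw [lintegral_eq_lintegral_meas_lt _ (.of_forall f0) hf.aemeasurable,
    lintegral_eq_lintegral_meas_lt _ (.of_forall g0) hg.aemeasurable,
    lintegral_eq_lintegral_meas_lt _ (.of_forall h0) hh.aemeasurable]
  have anti : ∀ u : ℝ → ℝ, Measurable fun t : ℝ => volume {a : ℝ | t < u a} := fun u =>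
    Antitone.measurable fun s t hst => measure_mono fun a ha => lt_of_le_of_lt hst ha
  rw [← lintegral_add_left (anti f), ← lintegral_const_mul _ (anti h)]
  refine setLIntegral_mono ((anti h).const_mul _) fun t ht => ?_
  have ht : 0 < t := ht
  by_cases ht1 : t < 1
  · refine bm (measurableSet_lt measurable_const hf) (measurableSet_lt measurable_const hg)
      (f2 t ht1) (g2 t ht1) fun x hx y hy z hz => ?_
    have hx : t < f x := hx
    have hy : t < g y := hy
    have := H x y z hz
    have : t < h z := by
      refine lt_of_pow_lt_pow_left₀ 2 (h0 z) ?_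
      nlinarith
    exact this
  · have e1 : {a | t < f a} = ∅ := by
      ext a; simp; linarith [f1 a]
    have e2 : {a | t < g a} = ∅ := by
      ext a; simp; linarith [g1 a]
    simp [e1, e2]

lemma ennreal_amgm {a b c : ENNReal} (h : a + b ≤ 2 * c) : a * b ≤ c ^ 2 := by
  by_cases hc : c = ⊤
  · simp [hc]
  have h2 : 2 * c ≠ ⊤ := ENNReal.mul_ne_top (by simp) hc
  have ha : a ≠ ⊤ := ne_top_of_le_ne_top h2 (le_self_add.trans h)
  have hb : b ≠ ⊤ := ne_top_of_le_ne_top h2 (le_add_self.trans h)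
  lift a to NNReal using ha
  lift b to NNReal using hb
  lift c to NNReal using hc
  norm_cast at *
  rw [← NNReal.coe_le_coe] at *
  push_cast at *
  nlinarith [sq_nonneg ((a:ℝ) - b), a.2, b.2, c.2]

lemma pl_bdd {f g h : ℝ → ℝ} (hf : Measurable f) (hg : Measurable g) (hh : Measurable h)
    (f0 : ∀ x, 0 ≤ f x) (g0 : ∀ x, 0 ≤ g x) (h0 : ∀ x, 0 ≤ h x)
    (f1 : BddAbove (Set.range f)) (g1 : BddAbove (Set.range g))
    (H : ∀ x y z, z + z = x + y → f x * g y ≤ h z ^ 2) :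
    (∫⁻ x, ENNReal.ofReal (f x)) * ∫⁻ x, ENNReal.ofReal (g x)
      ≤ (∫⁻ x, ENNReal.ofReal (h x)) ^ 2 := by
  by_cases hfz : ∀ x, f x = 0
  · simp [hfz]
  by_cases hgz : ∀ x, g x = 0
  · simp [hgz]
  push Not at hfz hgz
  set M := ⨆ x, f x with hM
  set N := ⨆ x, g x with hN
  have M0 : 0 < M := by
    obtain ⟨x, hx⟩ := hfz
    exact lt_of_lt_of_le (lt_of_le_of_ne (f0 x) (Ne.symm hx)) (le_ciSup f1 x)
  have N0 : 0 < N := by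
    obtain ⟨x, hx⟩ := hgz
    exact lt_of_lt_of_le (lt_of_le_of_ne (g0 x) (Ne.symm hx)) (le_ciSup g1 x)
  have S0 : 0 < √(M * N) := by positivity
  have key := pl_norm (f := fun x => f x / M) (g := fun x => g x / N)
    (h := fun x => h x / √(M * N)) (by fun_prop) (by fun_prop) (by fun_prop)
    (fun x => div_nonneg (f0 x) M0.le) (fun x => div_nonneg (g0 x) N0.le)
    (fun x => div_nonneg (h0 x) S0.le)
    (fun x => (div_le_one M0).2 (le_ciSup f1 x)) (fun x => (div_le_one N0).2 (le_ciSup g1 x))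
    (fun t ht => by
      obtain ⟨x, hx⟩ := exists_lt_of_lt_ciSup (show t * M < ⨆ x, f x by rw [← hM]; nlinarith)
      exact ⟨x, (lt_div_iff₀ M0).2 hx⟩)
    (fun t ht => by
      obtain ⟨x, hx⟩ := exists_lt_of_lt_ciSup (show t * N < ⨆ x, g x by rw [← hN]; nlinarith)
      exact ⟨x, (lt_div_iff₀ N0).2 hx⟩)
    (fun x y z hz => by
      rw [div_pow, Real.sq_sqrt (by positivity), div_mul_div_comm]
      exact div_le_div_of_nonneg_right (H x y z hz) (by positivity))
  have sc : ∀ (u : ℝ → ℝ) (hu : Measurable u) (c : ℝ) (hc : 0 < c),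
      ∫⁻ x, ENNReal.ofReal (u x) = ENNReal.ofReal c * ∫⁻ x, ENNReal.ofReal (u x / c) := by
    intro u hu c hc
    rw [← lintegral_const_mul _ (by fun_prop)]
    refine lintegral_congr fun x => ?_
    rw [← ENNReal.ofReal_mul hc.le]
    congr 1
    field_simp
  rw [sc f hf M M0, sc g hg N N0, sc h hh _ S0, mul_pow, ← ENNReal.ofReal_pow S0.le,
    Real.sq_sqrt (by positivity), ENNReal.ofReal_mul M0.le, mul_mul_mul_comm]
  exact mul_le_mul_right (ennreal_amgm key) _

/-- The midpoint Prékopa–Leindler property. -/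
def PL (E : Type) [AddCommGroup E] [MeasureSpace E] : Prop :=
  ∀ f g h : E → ENNReal, Measurable f → Measurable g → Measurable h →
    (∀ x y z, z + z = x + y → f x * g y ≤ h z ^ 2) →
    (∫⁻ x, f x) * ∫⁻ x, g x ≤ (∫⁻ x, h x) ^ 2

lemma PL_real : PL ℝ := by
  intro f g h hf hg hh H
  have tr : ∀ u : ℝ → ENNReal, Measurable u →
      ∫⁻ x, u x = ⨆ k : ℕ, ∫⁻ x, min (u x) k := by
    intro u hu
    rw [← lintegral_iSup (f := fun (k : ℕ) x => min (u x) k) (fun k => hu.min measurable_const)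
      (fun i j hij x => min_le_min_left _ (by exact_mod_cast hij))]
    refine lintegral_congr fun x => ?_
    rw [← inf_iSup_eq, ENNReal.iSup_natCast]
    simp
  have fin : ∀ (u : ℝ → ENNReal) (k : ℕ) x, min (u x) k ≠ ⊤ := fun u k x =>
    ne_top_of_le_ne_top (ENNReal.natCast_ne_top k) (min_le_right _ _)
  have key : ∀ k : ℕ, (∫⁻ x, min (f x) k) * ∫⁻ x, min (g x) k ≤ (∫⁻ x, h x) ^ 2 := by
    intro k
    have b : ∀ u : ℝ → ENNReal, BddAbove (Set.range fun x => (min (u x) k).toReal) := by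
      intro u
      refine ⟨k, ?_⟩
      rintro _ ⟨x, rfl⟩
      have := ENNReal.toReal_mono (ENNReal.natCast_ne_top k) (min_le_right (u x) k)
      simpa using this
    have := pl_bdd (f := fun x => (min (f x) k).toReal) (g := fun x => (min (g x) k).toReal)
      (h := fun x => (min (h x) k).toReal) (by fun_prop) (by fun_prop) (by fun_prop)
      (fun _ => ENNReal.toReal_nonneg) (fun _ => ENNReal.toReal_nonneg)
      (fun _ => ENNReal.toReal_nonneg) (b f) (b g) (fun x y z hz => by
        rw [← ENNReal.toReal_mul, ← ENNReal.toReal_pow]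
        refine ENNReal.toReal_mono (ENNReal.pow_ne_top (fin _ _ _)) ?_
        rcases le_total (h z) k with hk | hk
        · rw [min_eq_left hk]
          exact (mul_le_mul' (min_le_left _ _) (min_le_left _ _)).trans (H x y z hz)
        · rw [min_eq_right hk, sq]
          exact mul_le_mul' (min_le_right _ _) (min_le_right _ _))
    simp only [ENNReal.ofReal_toReal (fin _ _ _)] at this
    refine this.trans ?_
    gcongr
    exact min_le_left _ _
  have mono : ∀ u : ℝ → ENNReal, Monotone fun k : ℕ => ∫⁻ x, min (u x) k := fun u i j hij =>
    lintegral_mono fun x => min_le_min_left _ (by exact_mod_cast hij)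
  rw [tr f hf, tr g hg, ENNReal.iSup_mul]
  refine iSup_le fun i => ?_
  rw [ENNReal.mul_iSup]
  refine iSup_le fun j => ?_
  exact (mul_le_mul' (mono f (le_max_left i j)) (mono g (le_max_right i j))).trans (key _)

lemma PL_prod {E F : Type} [AddCommGroup E] [MeasureSpace E] [AddCommGroup F] [MeasureSpace F]
    [SFinite (volume : Measure E)] [SFinite (volume : Measure F)]
    (hE : PL E) (hF : PL F) : PL (E × F) := by
  intro f g h hf hg hh H
  rw [Measure.volume_eq_prod, lintegral_prod _ hf.aemeasurable, lintegral_prod _ hg.aemeasurable,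
    lintegral_prod _ hh.aemeasurable]
  refine hE _ _ _ hf.lintegral_prod_right' hg.lintegral_prod_right' hh.lintegral_prod_right' ?_
  intro x y z hz
  refine hF _ _ _ (by fun_prop) (by fun_prop) (by fun_prop) ?_
  intro x' y' z' hz'
  exact H _ _ _ (by simp [hz, hz'])

lemma PL_equiv {E F : Type} [AddCommGroup E] [MeasureSpace E] [AddCommGroup F] [MeasureSpace F]
    (e : E ≃ᵐ F) (he : MeasurePreserving e) (hadd : ∀ x y, e (x + y) = e x + e y)
    (hF : PL F) : PL E := by
  intro f g h hf hg hh H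
  have s := he.symm
  rw [← s.lintegral_comp hf, ← s.lintegral_comp hg, ← s.lintegral_comp hh]
  refine hF _ _ _ (hf.comp s.measurable) (hg.comp s.measurable) (hh.comp s.measurable) ?_
  intro x y z hz
  apply H
  apply e.injective
  simp [hadd, hz]

lemma PL_pi : ∀ n : ℕ, PL (Fin n → ℝ)
  | 0 => by
    intro f g h hf hg hh H
    rw [volume_pi, Measure.pi_of_empty _ 0]
    simp only [lintegral_dirac]
    exact H _ _ _ rfl
  | n + 1 => by
    refine PL_equiv _ (volume_preserving_piFinSuccAbove (fun _ : Fin (n + 1) => ℝ) 0) ?_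
      (PL_prod PL_real (PL_pi n))
    intro x y
    rfl

lemma PL_euclid (n : ℕ) : PL (EuclideanSpace ℝ (Fin n)) := by
  refine PL_equiv (MeasurableEquiv.toLp 2 (Fin n → ℝ)).symm ?_ ?_ (PL_pi n)
  · exact EuclideanSpace.volume_preserving_symm_measurableEquiv_toLp _
  · intro x y
    rfl

lemma exp_neg_cubic {v : ℝ} (hv : 0 ≤ v) : 1 - v + v ^ 2 / 2 - v ^ 3 / 6 ≤ Real.exp (-v) := by
  have h2 : MonotoneOn (fun v : ℝ => 1 - v + v ^ 2 / 2 - Real.exp (-v)) (Set.Ici 0) := by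
    refine monotoneOn_of_hasDerivWithinAt_nonneg
      (f' := fun v => - 1 + v + Real.exp (-v)) (convex_Ici 0) (by fun_prop) ?_ ?_
    · intro x _
      have := ((((hasDerivAt_id x).const_sub 1).add (((hasDerivAt_id x).pow 2).div_const 2)).sub
        (hasDerivAt_id x).neg.exp)
      refine (this.congr_deriv ?_).hasDerivWithinAt
      simp
    · intro x _
      have := Real.add_one_le_exp (-x)
      linarith
  have h3 : MonotoneOn (fun v : ℝ => Real.exp (-v) - (1 - v + v ^ 2 / 2 - v ^ 3 / 6))
      (Set.Ici 0) := by
    refine monotoneOn_of_hasDerivWithinAt_nonneg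
      (f' := fun v => 1 - v + v ^ 2 / 2 - Real.exp (-v)) (convex_Ici 0) (by fun_prop) ?_ ?_
    · intro x _
      have := (hasDerivAt_id x).neg.exp.sub
        ((((hasDerivAt_id x).const_sub 1).add (((hasDerivAt_id x).pow 2).div_const 2)).sub
        (((hasDerivAt_id x).pow 3).div_const 6))
      refine (this.congr_deriv ?_).hasDerivWithinAt
      simp
      ring
    · intro x hx
      rw [interior_Ici] at hx
      have := h2 (Set.mem_Ici.2 le_rfl) (Set.mem_Ici.2 (le_of_lt hx)) (le_of_lt hx)
      simpa using this
  have := h3 (Set.mem_Ici.2 le_rfl) (Set.mem_Ici.2 hv) hv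
  simp at this
  linarith

/-- Density of the truncated Gaussian. -/
noncomputable def truncDens (n : ℕ) (K : Set (EuclideanSpace ℝ (Fin n)))
    (x : EuclideanSpace ℝ (Fin n)) : ENNReal :=
  (stdGaussian n K)⁻¹ * K.indicator (fun x =>
    ENNReal.ofReal ((2 * π) ^ (-(n : ℝ) / 2) * Real.exp (-‖x‖ ^ 2 / 2))) x

lemma measurable_truncDens (n : ℕ) {K : Set (EuclideanSpace ℝ (Fin n))} (hK : MeasurableSet K) :
    Measurable (truncDens n K) := by
  unfold truncDens
  refine Measurable.const_mul (Measurable.indicator ?_ hK) _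
  fun_prop

lemma truncGaussian_eq (n : ℕ) {K : Set (EuclideanSpace ℝ (Fin n))} (hK : MeasurableSet K) :
    truncGaussian n K = volume.withDensity (truncDens n K) := by
  unfold truncGaussian truncDens
  conv_lhs => enter [2]; unfold _root_.stdGaussian
  rw [restrict_withDensity hK, ← withDensity_indicator hK]
  have := withDensity_smul (μ := (volume : Measure (EuclideanSpace ℝ (Fin n))))
    (stdGaussian n K)⁻¹ (f := K.indicator (fun x =>
    ENNReal.ofReal ((2 * π) ^ (-(n : ℝ) / 2) * Real.exp (-‖x‖ ^ 2 / 2))))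
    (Measurable.indicator (by fun_prop) hK)
  rw [← this]
  rfl

lemma truncDens_mid (n : ℕ) {K : Set (EuclideanSpace ℝ (Fin n))} (hconv : Convex ℝ K)
    {e : ℝ} (e0 : 0 < e) (e1 : e < 1) (x y z : EuclideanSpace ℝ (Fin n)) (hz : z + z = x + y) :
    (truncDens n K x * ENNReal.ofReal (Real.exp (e / (2 * (1 + e)) * ‖x‖ ^ 2))) *
    (truncDens n K y * ENNReal.ofReal (Real.exp (-(e / (2 * (1 - e)) * ‖y‖ ^ 2))))
      ≤ truncDens n K z ^ 2 := by
  by_cases hx : x ∈ K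
  swap
  · simp [truncDens, hx]
  by_cases hy : y ∈ K
  swap
  · simp [truncDens, hy]
  have hz' : z = (1/2 : ℝ) • x + (1/2 : ℝ) • y := by
    rw [← smul_add, ← hz, ← two_smul ℝ z, smul_smul]
    norm_num
  have hzK : z ∈ K := by
    rw [hz']
    exact hconv hx hy (by norm_num) (by norm_num) (by norm_num)
  simp only [truncDens, hx, hy, hzK, Set.indicator_of_mem]
  set c := (stdGaussian n K)⁻¹
  set p : ℝ := (2 * π) ^ (-(n : ℝ) / 2)
  have p0 : 0 ≤ p := by positivity
  have hn : ‖z‖ ^ 2 ≤ (‖x‖ ^ 2 / (1 + e) + ‖y‖ ^ 2 / (1 - e)) / 2 := by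
    have h1 : ‖z‖ ≤ (‖x‖ + ‖y‖) / 2 := by
      rw [hz']
      refine (norm_add_le _ _).trans (le_of_eq ?_)
      rw [norm_smul, norm_smul]
      norm_num
      ring
    have h2 : ‖z‖ ^ 2 ≤ ((‖x‖ + ‖y‖) / 2) ^ 2 := by gcongr
    refine h2.trans ?_
    have hp : 0 < 1 + e := by linarith
    have hm : 0 < 1 - e := by linarith
    have : (‖x‖ ^ 2 / (1 + e) + ‖y‖ ^ 2 / (1 - e)) / 2 - ((‖x‖ + ‖y‖) / 2) ^ 2
        = ((1 - e) * ‖x‖ - (1 + e) * ‖y‖) ^ 2 / (4 * (1 + e) * (1 - e)) := by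
      field_simp
      ring
    have : 0 ≤ ((1 - e) * ‖x‖ - (1 + e) * ‖y‖) ^ 2 / (4 * (1 + e) * (1 - e)) := by positivity
    linarith
  have key : (p * Real.exp (-‖x‖ ^ 2 / 2)) * Real.exp (e / (2 * (1 + e)) * ‖x‖ ^ 2) *
      ((p * Real.exp (-‖y‖ ^ 2 / 2)) * Real.exp (-(e / (2 * (1 - e)) * ‖y‖ ^ 2)))
      ≤ (p * Real.exp (-‖z‖ ^ 2 / 2)) ^ 2 := by
    have e1 : (p * Real.exp (-‖x‖ ^ 2 / 2)) * Real.exp (e / (2 * (1 + e)) * ‖x‖ ^ 2) *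
      ((p * Real.exp (-‖y‖ ^ 2 / 2)) * Real.exp (-(e / (2 * (1 - e)) * ‖y‖ ^ 2)))
      = p ^ 2 * Real.exp (-((‖x‖ ^ 2 / (1 + e) + ‖y‖ ^ 2 / (1 - e)) / 2)) := by
      have : -((‖x‖ ^ 2 / (1 + e) + ‖y‖ ^ 2 / (1 - e)) / 2) =
        (-‖x‖ ^ 2 / 2 + (e / (2 * (1 + e)) * ‖x‖ ^ 2)) +
        (-‖y‖ ^ 2 / 2 + (-(e / (2 * (1 - e)) * ‖y‖ ^ 2))) := by
        have hp : 1 + e ≠ 0 := by linarith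
        have hm : 1 - e ≠ 0 := by linarith
        field_simp
        ring
      rw [this, Real.exp_add, Real.exp_add, Real.exp_add]
      ring
    rw [e1, mul_pow, ← Real.exp_nat_mul]
    gcongr
    push_cast
    linarith
  have re : ∀ u v w t : ENNReal, c * u * v * (c * w * t) = c ^ 2 * (u * v * (w * t)) := by
    intro u v w t
    ring
  rw [re, mul_pow]
  refine mul_le_mul_right ?_ _
  rw [← ENNReal.ofReal_mul (by positivity), ← ENNReal.ofReal_mul (by positivity),
    ← ENNReal.ofReal_mul (by positivity), ← ENNReal.ofReal_pow (by positivity)]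
  exact ENNReal.ofReal_le_ofReal key

lemma trunc_pl (n : ℕ) {K : Set (EuclideanSpace ℝ (Fin n))} (hconv : Convex ℝ K)
    (hK : MeasurableSet K) [IsProbabilityMeasure (truncGaussian n K)]
    {e : ℝ} (e0 : 0 < e) (e1 : e < 1) :
    (∫⁻ x, ENNReal.ofReal (Real.exp (e / (2 * (1 + e)) * ‖x‖ ^ 2)) ∂(truncGaussian n K)) *
    (∫⁻ x, ENNReal.ofReal (Real.exp (-(e / (2 * (1 - e)) * ‖x‖ ^ 2))) ∂(truncGaussian n K))
      ≤ 1 := by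
  have hd := measurable_truncDens n hK
  have h1 : ∫⁻ x, truncDens n K x = 1 := by
    rw [← measure_univ (μ := truncGaussian n K), truncGaussian_eq n hK,
      withDensity_apply _ MeasurableSet.univ, setLIntegral_univ]
  rw [truncGaussian_eq n hK, lintegral_withDensity_eq_lintegral_mul _ hd (by fun_prop),
    lintegral_withDensity_eq_lintegral_mul _ hd (by fun_prop)]
  refine (PL_euclid n _ _ (truncDens n K) (hd.mul (by fun_prop)) (hd.mul (by fun_prop)) hd
    (truncDens_mid n hconv e0 e1)).trans ?_
  rw [h1, one_pow]

lemma final_limit {m1 m2 m3 : ℝ} (h1 : 0 ≤ m1) (h2 : 0 ≤ m2) (H : ∀ e : ℝ, 0 < e → e < 1 / 2 →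
    0 ≤ 1 - (e / (2 * (1 - e))) * m1 + (e / (2 * (1 - e))) ^ 2 / 2 * m2
      - (e / (2 * (1 - e))) ^ 3 / 6 * m3 →
    (1 + (e / (2 * (1 + e))) * m1 + (e / (2 * (1 + e))) ^ 2 / 2 * m2) *
    (1 - (e / (2 * (1 - e))) * m1 + (e / (2 * (1 - e))) ^ 2 / 2 * m2
      - (e / (2 * (1 - e))) ^ 3 / 6 * m3) ≤ 1) :
    m2 - m1 ^ 2 ≤ 4 * m1 := by
  let a : ℝ → ℝ := fun e => 1 / (2 * (1 + e))
  let b : ℝ → ℝ := fun e => 1 / (2 * (1 - e))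
  let Q : ℝ → ℝ := fun e => 1 - (e * b e) * m1 + (e * b e) ^ 2 / 2 * m2 - (e * b e) ^ 3 / 6 * m3
  let G : ℝ → ℝ := fun e => - (4 * a e * b e) * m1 + b e ^ 2 / 2 * m2 - e * b e ^ 3 / 6 * m3
    + a e * m1 * (- b e * m1 + e * b e ^ 2 / 2 * m2 - e ^ 2 * b e ^ 3 / 6 * m3)
    + a e ^ 2 / 2 * m2 * Q e
  have ca : ContinuousAt a 0 := by
    refine ContinuousAt.div (by fun_prop) (by fun_prop) (by norm_num)
  have cb : ContinuousAt b 0 := by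
    refine ContinuousAt.div (by fun_prop) (by fun_prop) (by norm_num)
  have cQ : ContinuousAt Q 0 := by fun_prop
  have cG : ContinuousAt G 0 := by fun_prop
  have Q0 : Q 0 = 1 := by simp [Q]
  have G0 : G 0 = - m1 + m2 / 4 - m1 ^ 2 / 4 := by
    simp [G, a, b, Q0]
    ring
  have evQ : ∀ᶠ e in nhdsWithin (0 : ℝ) (Set.Ioi 0), 0 < Q e :=
    (cQ.eventually (lt_mem_nhds (by rw [Q0]; norm_num))).filter_mono nhdsWithin_le_nhds
  have evh : ∀ᶠ e in nhdsWithin (0 : ℝ) (Set.Ioi 0), e < 1 / 2 :=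
    (gt_mem_nhds (by norm_num) : ∀ᶠ e in nhds (0:ℝ), e < 1 / 2).filter_mono nhdsWithin_le_nhds
  have evG : ∀ᶠ e in nhdsWithin (0 : ℝ) (Set.Ioi 0), G e ≤ 0 := by
    filter_upwards [evQ, evh, self_mem_nhdsWithin] with e hQ he e0
    have e0 : 0 < e := e0
    have ea : e / (2 * (1 + e)) = e * a e := by simp [a, div_eq_mul_inv]
    have eb : e / (2 * (1 - e)) = e * b e := by simp [b, div_eq_mul_inv]
    have := H e e0 he (by rw [eb]; exact hQ.le)
    rw [ea, eb] at this
    have hab : a e - b e = - e * (4 * a e * b e) := by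
      have hp : 1 + e ≠ 0 := by linarith
      have hm : 1 - e ≠ 0 := by linarith
      simp only [a, b]
      field_simp
      ring
    have : e ^ 2 * G e ≤ 0 := by
      have id : e ^ 2 * G e = (1 + (e * a e) * m1 + (e * a e) ^ 2 / 2 * m2) *
        (1 - (e * b e) * m1 + (e * b e) ^ 2 / 2 * m2 - (e * b e) ^ 3 / 6 * m3) - 1 := by
        simp only [G, Q]
        linear_combination (- e * m1) * hab
      rw [id]
      linarith
    by_contra hG
    push Not at hG
    have : 0 < e ^ 2 * G e := by positivity
    linarith
  have := le_of_tendsto (cG.tendsto.mono_left nhdsWithin_le_nhds) evG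
  rw [G0] at this
  linarith

/-- for a convex set `K ⊆ ℝⁿ` (not necessarily symmetric) of positive
Gaussian volume, `Var[‖x‖²] ≤ 4·E[‖x‖²]` under `N(0,I_n)|K`. -/
theorem variance_sq_norm_truncated_gaussian_le
    (n : ℕ) (K : Set (EuclideanSpace ℝ (Fin n)))
    (hconv : Convex ℝ K) (hmeas : MeasurableSet K)
    (hpos : 0 < (stdGaussian n K).toReal) :
    variance (fun x => ‖x‖ ^ 2) (truncGaussian n K)
      ≤ 4 * ∫ x, ‖x‖ ^ 2 ∂(truncGaussian n K) := by
  obtain ⟨hp0, hpt⟩ := ENNReal.toReal_pos_iff.1 hpos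
  haveI : IsProbabilityMeasure (truncGaussian n K) := by
    constructor
    simp only [truncGaussian, Measure.smul_apply, Measure.restrict_apply_univ, smul_eq_mul]
    exact ENNReal.inv_mul_cancel hp0.ne' hpt.ne
  have pl := fun {e : ℝ} (e0 : 0 < e) (e1 : e < 1) => trunc_pl n hconv hmeas e0 e1
  set D := truncGaussian n K with hD
  -- integrability of exponentials
  have ineg : ∀ b : ℝ, 0 ≤ b → Integrable (fun x => Real.exp (-(b * ‖x‖ ^ 2))) D := by
    intro b hb
    refine Integrable.of_bound (by fun_prop) 1 (.of_forall fun x => ?_)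
    rw [Real.norm_eq_abs, Real.abs_exp, Real.exp_le_one_iff]
    have : 0 ≤ b * ‖x‖ ^ 2 := by positivity
    linarith
  have ipos : ∀ {e : ℝ}, 0 < e → e < 1 →
      Integrable (fun x => Real.exp (e / (2 * (1 + e)) * ‖x‖ ^ 2)) D := by
    intro e e0 e1
    refine ⟨by fun_prop, ?_⟩
    rw [hasFiniteIntegral_iff_ofReal (.of_forall fun x => (Real.exp_pos _).le)]
    have h := pl e0 e1
    by_contra hc
    rw [not_lt, top_le_iff] at hc
    rw [hc, ENNReal.top_mul] at h
    · simp at h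
    · rw [← pos_iff_ne_zero, lintegral_pos_iff_support (by fun_prop)]
      have : Function.support (fun x : EuclideanSpace ℝ (Fin n) =>
        ENNReal.ofReal (Real.exp (-(e / (2 * (1 - e)) * ‖x‖ ^ 2)))) = Set.univ := by
        ext x
        simp [Real.exp_pos]
      rw [this]
      simp
  have imom : ∀ k : ℕ, Integrable (fun x => (‖x‖ ^ 2) ^ k) D := by
    intro k
    have h := ipos (e := 1 / 2) (by norm_num) (by norm_num)
    refine (h.const_mul (6 ^ k * k.factorial : ℝ)).mono' (by fun_prop) (.of_forall fun x => ?_)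
    have := Real.pow_div_factorial_le_exp (‖x‖ ^ 2 / 6) (by positivity) k
    rw [div_le_iff₀ (by positivity), div_pow, div_le_iff₀ (by positivity)] at this
    rw [Real.norm_of_nonneg (by positivity)]
    refine this.trans (le_of_eq ?_)
    rw [show (1 / 2 / (2 * (1 + 1 / 2)) * ‖x‖ ^ 2 : ℝ) = ‖x‖ ^ 2 / 6 by ring]
    ring
  have i1 : Integrable (fun x => ‖x‖ ^ 2) D := by simpa using imom 1
  have i2 := imom 2
  have i3 := imom 3
  have hv : variance (fun x => ‖x‖ ^ 2) D = ∫ x, (‖x‖ ^ 2) ^ 2 ∂D - (∫ x, ‖x‖ ^ 2 ∂D) ^ 2 := by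
    rw [variance_eq_sub]
    · rfl
    · rw [memLp_two_iff_integrable_sq (by fun_prop)]
      exact i2
  rw [hv]
  refine final_limit (m3 := ∫ x, (‖x‖ ^ 2) ^ 3 ∂D) (integral_nonneg fun x => by positivity)
    (integral_nonneg fun x => by positivity) ?_
  intro e e0 e1 hQ
  have hpl := pl e0 (by linarith)
  have hb0 : 0 ≤ e / (2 * (1 - e)) := div_nonneg e0.le (by linarith)
  have ha0 : 0 ≤ e / (2 * (1 + e)) := by positivity
  have ip := ipos e0 (by linarith)
  have im := ineg _ hb0
  rw [← ofReal_integral_eq_lintegral_ofReal ip (.of_forall fun x => (Real.exp_pos _).le),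
    ← ofReal_integral_eq_lintegral_ofReal im (.of_forall fun x => (Real.exp_pos _).le),
    ← ENNReal.ofReal_mul (integral_nonneg fun x => (Real.exp_pos _).le),
    ENNReal.ofReal_le_one] at hpl
  refine le_trans (mul_le_mul ?_ ?_ hQ (integral_nonneg fun x => (Real.exp_pos _).le)) hpl
  · generalize e / (2 * (1 + e)) = a at *
    have : ∫ x, (1 + a * ‖x‖ ^ 2 + a ^ 2 / 2 * (‖x‖ ^ 2) ^ 2) ∂D =
        1 + a * (∫ x, ‖x‖ ^ 2 ∂D) + a ^ 2 / 2 * ∫ x, (‖x‖ ^ 2) ^ 2 ∂D := by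
      rw [integral_add (by fun_prop) (by fun_prop), integral_add (by fun_prop) (by fun_prop),
        integral_const_mul, integral_const_mul]
      simp
    rw [← this]
    refine integral_mono (by fun_prop) ip fun x => ?_
    have := Real.quadratic_le_exp_of_nonneg (x := a * ‖x‖ ^ 2) (by positivity)
    simp only
    linarith
  · generalize e / (2 * (1 - e)) = b at *
    have : ∫ x, (1 - b * ‖x‖ ^ 2 + b ^ 2 / 2 * (‖x‖ ^ 2) ^ 2 - b ^ 3 / 6 * (‖x‖ ^ 2) ^ 3) ∂D =
        1 - b * (∫ x, ‖x‖ ^ 2 ∂D) + b ^ 2 / 2 * (∫ x, (‖x‖ ^ 2) ^ 2 ∂D)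
          - b ^ 3 / 6 * ∫ x, (‖x‖ ^ 2) ^ 3 ∂D := by
      rw [integral_sub (by fun_prop) (by fun_prop), integral_add (by fun_prop) (by fun_prop),
        integral_sub (by fun_prop) (by fun_prop),
        integral_const_mul, integral_const_mul, integral_const_mul]
      simp
    rw [← this]
    refine integral_mono (by fun_prop) im fun x => ?_
    have := exp_neg_cubic (v := b * ‖x‖ ^ 2) (by positivity)
    simp only
    linarith
end

section
/- There exist absolute constants c, C > 0 such that for every n ∈ ℕ, every ε ∈ (0,1), and every integer T ≥ C·n/ε², the following two statements hold. (i) If x⁽¹⁾, …, x⁽ᵀ⁾ are i.i.d. draws from γ_n, then P[(1/T)·∑_{i=1}^T ‖x⁽ⁱ⁾‖² < n − cε/2] ≤ 1/10. (ii) If K ⊆ ℝⁿ is a symmetric convex set with 0 < vol(K) ≤ 1 − ε and x⁽¹⁾, …, x⁽ᵀ⁾ are i.i.d. draws from N(0,I_n)|K, then P[(1/T)·∑_{i=1}^T ‖x⁽ⁱ⁾‖² ≥ n − cε/2] ≤ 1/10. -/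
open MeasureTheory ProbabilityTheory Real

open scoped ENNReal in
theorem bm_one_dim_compact {l m : ℝ} (hl : 0 < l) (hm : 0 < m) {A B S : Set ℝ}
    (hA : IsCompact A) (hB : IsCompact B) (hA0 : A.Nonempty) (hB0 : B.Nonempty)
    (h : ∀ x ∈ A, ∀ y ∈ B, l * x + m * y ∈ S) :
    ENNReal.ofReal l * volume A + ENNReal.ofReal m * volume B ≤ volume S := by
  obtain ⟨a, haA, ha⟩ := hA.exists_isGreatest hA0
  obtain ⟨b, hbB, hb⟩ := hB.exists_isLeast hB0
  set A' := (fun x => l * x + m * b) '' A with hA'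
  set B' := (fun y => m * y + l * a) '' B with hB'
  have vA : volume A' = ENNReal.ofReal l * volume A := by
    have : A' = (fun z => z + m * b) '' ((fun x => l * x) '' A) := by
      rw [hA', Set.image_image]
    rw [this, Set.image_add_right, measure_preimage_add_right]
    have := Measure.addHaar_smul (volume : Measure ℝ) l A
    rw [Module.finrank_self, pow_one, abs_of_pos hl] at this
    exact this
  have vB : volume B' = ENNReal.ofReal m * volume B := by
    have : B' = (fun z => z + l * a) '' ((fun x => m * x) '' B) := by
      rw [hB', Set.image_image]
    rw [this, Set.image_add_right, measure_preimage_add_right]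
    have := Measure.addHaar_smul (volume : Measure ℝ) m B
    rw [Module.finrank_self, pow_one, abs_of_pos hm] at this
    exact this
  have cB : IsCompact B' := hB.image (by fun_prop)
  have hdis : AEDisjoint volume A' B' := by
    have : A' ∩ B' ⊆ {l * a + m * b} := by
      rintro z ⟨⟨x, hx, rfl⟩, ⟨y, hy, hxy⟩⟩
      have h1 := ha hx
      have h2 := hb hy
      simp only [Set.mem_singleton_iff] at *
      nlinarith
    exact measure_mono_null this (by simp)
  rw [← vA, ← vB, ← measure_union₀ cB.measurableSet.nullMeasurableSet hdis]
  apply measure_mono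
  rintro z (⟨x, hx, rfl⟩ | ⟨y, hy, rfl⟩)
  · exact h x hx b hbB
  · have := h a haA y hy
    simpa [add_comm] using this

theorem bm_one_dim {l m : ℝ} (hl : 0 < l) (hm : 0 < m) {A B S : Set ℝ}
    (hA : MeasurableSet A) (hB : MeasurableSet B) (hA0 : A.Nonempty) (hB0 : B.Nonempty)
    (h : ∀ x ∈ A, ∀ y ∈ B, l * x + m * y ∈ S) :
    ENNReal.ofReal l * volume A + ENNReal.ofReal m * volume B ≤ volume S := by
  obtain ⟨a, ha⟩ := hA0
  obtain ⟨b, hb⟩ := hB0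
  rw [hA.measure_eq_iSup_isCompact, hB.measure_eq_iSup_isCompact]
  simp only [ENNReal.mul_iSup]
  have key : ∀ K₁, K₁ ⊆ A → IsCompact K₁ → ∀ K₂, K₂ ⊆ B → IsCompact K₂ →
      ENNReal.ofReal l * volume K₁ + ENNReal.ofReal m * volume K₂ ≤ volume S := by
    intro K₁ h1 c1 K₂ h2 c2
    refine le_trans ?_ (bm_one_dim_compact hl hm (A := insert a K₁) (B := insert b K₂)
      (c1.insert a) (c2.insert b) (Set.insert_nonempty _ _) (Set.insert_nonempty _ _) ?_)
    · gcongr <;> exact Set.subset_insert _ _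
    · intro x hx y hy
      exact h x (Set.insert_subset ha h1 hx) y (Set.insert_subset hb h2 hy)
  have e1 : (⨆ K, ⨆ (_ : K ⊆ A), ⨆ (_ : IsCompact K), ENNReal.ofReal l * volume K)
      = ⨆ K : {K : Set ℝ // K ⊆ A ∧ IsCompact K}, ENNReal.ofReal l * volume K.1 := by
    rw [iSup_subtype]; simp only [iSup_and]
  have e2 : (⨆ K, ⨆ (_ : K ⊆ B), ⨆ (_ : IsCompact K), ENNReal.ofReal m * volume K)
      = ⨆ K : {K : Set ℝ // K ⊆ B ∧ IsCompact K}, ENNReal.ofReal m * volume K.1 := by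
    rw [iSup_subtype]; simp only [iSup_and]
  rw [e1, e2]
  have : Nonempty {K : Set ℝ // K ⊆ A ∧ IsCompact K} := ⟨∅, by simp⟩
  have : Nonempty {K : Set ℝ // K ⊆ B ∧ IsCompact K} := ⟨∅, by simp⟩
  exact ENNReal.iSup_add_iSup_le fun i j => key _ i.2.1 i.2.2 _ j.2.1 j.2.2

theorem ennreal_am_gm {l m : ℝ} (hl : 0 < l) (hm : 0 < m) (hlm : l + m = 1) (a b : ENNReal) :
    a ^ l * b ^ m ≤ ENNReal.ofReal l * a + ENNReal.ofReal m * b := by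
  by_cases ha : a = ⊤
  · rw [ha, ENNReal.mul_top (by simpa using hl)]; simp
  by_cases hb : b = ⊤
  · rw [hb, ENNReal.mul_top (by simpa using hm)]; simp
  lift a to NNReal using ha
  lift b to NNReal using hb
  have := NNReal.geom_mean_le_arith_mean2_weighted l.toNNReal m.toNNReal a b (by
    rw [← Real.toNNReal_add hl.le hm.le, hlm]; simp)
  rw [Real.coe_toNNReal _ hl.le, Real.coe_toNNReal _ hm.le] at this
  rw [← ENNReal.coe_rpow_of_nonneg _ hl.le, ← ENNReal.coe_rpow_of_nonneg _ hm.le]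
  unfold ENNReal.ofReal
  exact_mod_cast this

/-- One-dimensional Prekopa-Leindler, normalized. -/
theorem pl_one_norm {l m : ℝ} (hl : 0 < l) (hm : 0 < m) (hlm : l + m = 1) {f g h : ℝ → ENNReal}
    (hf : Measurable f) (hg : Measurable g) (hh : Measurable h)
    (hf1 : ⨆ x, f x = 1) (hg1 : ⨆ x, g x = 1)
    (H : ∀ x y, f x ^ l * g y ^ m ≤ h (l * x + m * y)) :
    ENNReal.ofReal l * (∫⁻ x, f x) + ENNReal.ofReal m * (∫⁻ x, g x) ≤ ∫⁻ x, h x := by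
  have f1 : ∀ x, f x ≤ 1 := fun x => hf1 ▸ le_iSup f x
  have g1 : ∀ x, g x ≤ 1 := fun x => hg1 ▸ le_iSup g x
  have lc : ∀ f : ℝ → ENNReal, Measurable f → (∀ x, f x ≤ 1) →
      ∫⁻ x, f x = ∫⁻ t in Set.Ioo (0:ℝ) 1, volume {x | ENNReal.ofReal t < f x} := by
    intro f hf f1
    have hft : ∀ x, f x ≠ ⊤ := fun x => ne_top_of_le_ne_top ENNReal.one_ne_top (f1 x)
    have := lintegral_eq_lintegral_meas_lt (volume : Measure ℝ) (f := fun x => (f x).toReal)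
      (Filter.Eventually.of_forall fun x => ENNReal.toReal_nonneg) hf.ennreal_toReal.aemeasurable
    simp only [ENNReal.ofReal_toReal (hft _)] at this
    rw [this, ← Set.Ioo_union_Ici_eq_Ioi (zero_lt_one' ℝ), lintegral_union measurableSet_Ici
      (Set.disjoint_left.2 fun x hx hx' => absurd hx.2 (not_lt.2 hx'))]
    have z : ∫⁻ t in Set.Ici (1:ℝ), volume {x | t < (f x).toReal} = 0 := by
      rw [setLIntegral_congr_fun (g := fun _ => 0) measurableSet_Ici]
      · simp
      · intro t ht
        have : {x | t < (f x).toReal} = ∅ := by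
          ext x
          simp only [Set.mem_ofPred_eq, Set.mem_empty_iff_false, iff_false, not_lt]
          refine le_trans ?_ (show (1:ℝ) ≤ t from ht)
          exact ENNReal.toReal_le_of_le_ofReal zero_le_one (by simpa using f1 x)
        simp [this]
    rw [z, add_zero]
    refine setLIntegral_congr_fun measurableSet_Ioo fun t ht => ?_
    congr 1
    ext x
    simp only [Set.mem_ofPred_eq]
    exact (ENNReal.ofReal_lt_iff_lt_toReal ht.1.le (hft x)).symm
  have hmin : ∫⁻ x, min (h x) 1 ≤ ∫⁻ x, h x := lintegral_mono fun x => min_le_left _ _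
  refine le_trans ?_ hmin
  have mf : Measurable fun t : ℝ => volume {x | ENNReal.ofReal t < f x} :=
    Antitone.measurable fun s t hst => measure_mono fun x hx =>
      lt_of_le_of_lt (ENNReal.ofReal_le_ofReal hst) hx
  rw [lc f hf f1, lc g hg g1, lc _ (hh.min measurable_const) (fun x => min_le_right _ _),
    ← lintegral_const_mul' _ _ ENNReal.ofReal_ne_top, ← lintegral_const_mul' _ _ ENNReal.ofReal_ne_top,
    ← lintegral_add_left (mf.const_mul _)]
  refine setLIntegral_mono' measurableSet_Ioo fun t ht => ?_
  have ht1 : ENNReal.ofReal t < 1 := by simpa using ht.2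
  refine bm_one_dim hl hm (measurableSet_lt measurable_const hf)
    (measurableSet_lt measurable_const hg) ?_ ?_ ?_
  · exact lt_iSup_iff.1 (hf1 ▸ ht1)
  · exact lt_iSup_iff.1 (hg1 ▸ ht1)
  · intro x hx y hy
    simp only [Set.mem_ofPred_eq] at hx hy ⊢
    refine lt_min (lt_of_lt_of_le ?_ (H x y)) ht1
    calc ENNReal.ofReal t = ENNReal.ofReal t ^ l * ENNReal.ofReal t ^ m := by
          rw [← ENNReal.rpow_add_of_nonneg _ _ hl.le hm.le, hlm, ENNReal.rpow_one]
      _ < _ := ENNReal.mul_lt_mul (ENNReal.rpow_lt_rpow hx hl) (ENNReal.rpow_lt_rpow hy hm)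

theorem pl_one_bdd {l m : ℝ} (hl : 0 < l) (hm : 0 < m) (hlm : l + m = 1) {f g h : ℝ → ENNReal}
    (hf : Measurable f) (hg : Measurable g) (hh : Measurable h)
    (hf1 : ⨆ x, f x ≠ ⊤) (hg1 : ⨆ x, g x ≠ ⊤)
    (H : ∀ x y, f x ^ l * g y ^ m ≤ h (l * x + m * y)) :
    (∫⁻ x, f x) ^ l * (∫⁻ x, g x) ^ m ≤ ∫⁻ x, h x := by
  set M := ⨆ x, f x with hM
  set N := ⨆ x, g x with hN
  by_cases hM0 : M = 0
  · have : ∀ x, f x = 0 := by simpa [hM] using hM0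
    simp [this, hl]
  by_cases hN0 : N = 0
  · have : ∀ x, g x = 0 := by simpa [hN] using hN0
    simp [this, hm]
  have hMi : M⁻¹ ≠ ⊤ := by simpa using hM0
  have hNi : N⁻¹ ≠ ⊤ := by simpa using hN0
  have hMi0 : M⁻¹ ≠ 0 := by simpa using hf1
  have hNi0 : N⁻¹ ≠ 0 := by simpa using hg1
  have key := pl_one_norm hl hm hlm (f := fun x => M⁻¹ * f x) (g := fun x => N⁻¹ * g x)
    (h := fun x => M⁻¹ ^ l * N⁻¹ ^ m * h x) (hf.const_mul _) (hg.const_mul _) (hh.const_mul _)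
    (by rw [← ENNReal.mul_iSup, ← hM, ENNReal.inv_mul_cancel hM0 hf1])
    (by rw [← ENNReal.mul_iSup, ← hN, ENNReal.inv_mul_cancel hN0 hg1])
    (by
      intro x y
      rw [ENNReal.mul_rpow_of_nonneg _ _ hl.le, ENNReal.mul_rpow_of_nonneg _ _ hm.le,
        mul_mul_mul_comm]
      gcongr
      exact H x y)
  have key2 := (ennreal_am_gm hl hm hlm _ _).trans key
  rw [lintegral_const_mul _ hf, lintegral_const_mul _ hg, lintegral_const_mul _ hh,
    ENNReal.mul_rpow_of_nonneg _ _ hl.le, ENNReal.mul_rpow_of_nonneg _ _ hm.le,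
    mul_mul_mul_comm] at key2
  refine (ENNReal.mul_le_mul_iff_right ?_ ?_).1 key2
  · exact mul_ne_zero (by simp [ENNReal.rpow_eq_zero_iff, hMi0, hMi, hl.not_gt])
      (by simp [ENNReal.rpow_eq_zero_iff, hNi0, hNi, hm.not_gt])
  · exact ENNReal.mul_ne_top (ENNReal.rpow_ne_top_of_nonneg hl.le hMi)
      (ENNReal.rpow_ne_top_of_nonneg hm.le hNi)

theorem pl_one {l m : ℝ} (hl : 0 < l) (hm : 0 < m) (hlm : l + m = 1) {f g h : ℝ → ENNReal}
    (hf : Measurable f) (hg : Measurable g) (hh : Measurable h)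
    (H : ∀ x y, f x ^ l * g y ^ m ≤ h (l * x + m * y)) :
    (∫⁻ x, f x) ^ l * (∫⁻ x, g x) ^ m ≤ ∫⁻ x, h x := by
  have tr : ∀ f : ℝ → ENNReal, Measurable f →
      ∫⁻ x, f x = ⨆ k : ℕ, ∫⁻ x, min (f x) k := by
    intro f hf
    rw [← lintegral_iSup (fun k => hf.min measurable_const)]
    · congr 1; ext x
      rw [← inf_iSup_eq, ENNReal.iSup_natCast, inf_top_eq]
    · intro i j hij x
      exact min_le_min_left _ (by exact_mod_cast hij)
  have key : ∀ k j : ℕ, (∫⁻ x, min (f x) k) ^ l * (∫⁻ x, min (g x) j) ^ m ≤ ∫⁻ x, h x := by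
    intro k j
    refine pl_one_bdd hl hm hlm (hf.min measurable_const) (hg.min measurable_const) hh ?_ ?_ ?_
    · exact ne_top_of_le_ne_top (ENNReal.natCast_ne_top k) (iSup_le fun x => min_le_right _ _)
    · exact ne_top_of_le_ne_top (ENNReal.natCast_ne_top j) (iSup_le fun x => min_le_right _ _)
    · intro x y
      refine le_trans ?_ (H x y)
      gcongr <;> exact min_le_left _ _
  have sr : ∀ (p : ℝ), 0 < p → ∀ u : ℕ → ENNReal, (⨆ k, u k) ^ p = ⨆ k, u k ^ p := by
    intro p hp u
    exact (ENNReal.orderIsoRpow p hp).map_iSup u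
  rw [tr f hf, tr g hg, sr l hl, sr m hm, ENNReal.iSup_mul]
  refine iSup_le fun k => ?_
  rw [ENNReal.mul_iSup]
  exact iSup_le fun j => key k j

theorem pl_pi {l m : ℝ} (hl : 0 < l) (hm : 0 < m) (hlm : l + m = 1) :
    ∀ (n : ℕ) {f g h : (Fin n → ℝ) → ENNReal},
    Measurable f → Measurable g → Measurable h →
    (∀ x y, f x ^ l * g y ^ m ≤ h (l • x + m • y)) →
    (∫⁻ x, f x) ^ l * (∫⁻ x, g x) ^ m ≤ ∫⁻ x, h x := by
  intro n
  induction n with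
  | zero =>
    intro f g h hf hg hh H
    have : ∀ f : (Fin 0 → ℝ) → ENNReal, ∫⁻ x, f x = f 0 := by
      intro f
      rw [lintegral_unique, volume_pi, Measure.pi_of_empty]
      rw [measure_univ, mul_one]
      exact congrArg f (Subsingleton.elim _ _)
    rw [this, this, this]
    refine (H 0 0).trans (le_of_eq (congrArg h (Subsingleton.elim _ _)))
  | succ n ih =>
    intro f g h hf hg hh H
    have mp := (volume_preserving_piFinSuccAbove (fun _ : Fin (n+1) => ℝ) 0).symm
    have e : ∀ f : (Fin (n+1) → ℝ) → ENNReal, Measurable f →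
        ∫⁻ x, f x = ∫⁻ a : ℝ, ∫⁻ z : Fin n → ℝ, f (Fin.cons a z) := by
      intro f hf
      rw [← mp.lintegral_comp hf, Measure.volume_eq_prod, lintegral_prod
        (fun p => f ((MeasurableEquiv.piFinSuccAbove (fun _ : Fin (n+1) => ℝ) 0).symm p))
        (hf.comp mp.measurable).aemeasurable]
      simp [MeasurableEquiv.piFinSuccAbove, Fin.insertNthEquiv]
    have mc : Measurable fun p : ℝ × (Fin n → ℝ) => (Fin.cons p.1 p.2 : Fin (n+1) → ℝ) := by
      refine measurable_pi_lambda _ fun i => ?_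
      refine Fin.cases ?_ (fun j => ?_) i <;> simp <;> fun_prop
    rw [e f hf, e g hg, e h hh]
    refine pl_one hl hm hlm (Measurable.lintegral_prod_right (f := fun a z => f (Fin.cons a z)) (hf.comp mc)) (Measurable.lintegral_prod_right (f := fun a z => g (Fin.cons a z)) (hg.comp mc))
      (Measurable.lintegral_prod_right (f := fun a z => h (Fin.cons a z)) (hh.comp mc)) fun a b => ?_
    refine ih (hf.comp (mc.comp measurable_prodMk_left)) (hg.comp (mc.comp measurable_prodMk_left))
      (hh.comp (mc.comp measurable_prodMk_left)) fun x y => ?_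
    refine (H (Fin.cons a x) (Fin.cons b y)).trans (le_of_eq ?_)
    congr 1
    ext i
    refine Fin.cases ?_ (fun j => ?_) i <;> simp

theorem pl_euc {l m : ℝ} (hl : 0 < l) (hm : 0 < m) (hlm : l + m = 1)
    (n : ℕ) {f g h : EuclideanSpace ℝ (Fin n) → ENNReal}
    (hf : Measurable f) (hg : Measurable g) (hh : Measurable h)
    (H : ∀ x y, f x ^ l * g y ^ m ≤ h (l • x + m • y)) :
    (∫⁻ x, f x) ^ l * (∫⁻ x, g x) ^ m ≤ ∫⁻ x, h x := by
  have mp := PiLp.volume_preserving_toLp (Fin n)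
  rw [← mp.lintegral_comp hf, ← mp.lintegral_comp hg, ← mp.lintegral_comp hh]
  refine pl_pi hl hm hlm n (hf.comp mp.measurable) (hg.comp mp.measurable) (hh.comp mp.measurable) ?_
  intro x y
  exact H _ _

local notation "EE" n => EuclideanSpace ℝ (Fin n)

theorem gauss_int {V : Type*} [NormedAddCommGroup V] [InnerProductSpace ℝ V]
    [FiniteDimensional ℝ V] [MeasurableSpace V] [BorelSpace V] {b : ℝ} (hb : 0 < b) :
    ∫⁻ v : V, ENNReal.ofReal (exp (-b * ‖v‖ ^ 2))
      = ENNReal.ofReal ((π / b) ^ (Module.finrank ℝ V / 2 : ℝ)) := by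
  have h := GaussianFourier.integral_rexp_neg_mul_sq_norm (V := V) hb
  rw [← h, ofReal_integral_eq_lintegral_ofReal]
  · by_contra hc
    rw [integral_undef hc] at h
    have : 0 < (π / b) ^ (Module.finrank ℝ V / 2 : ℝ) := by positivity
    linarith
  · exact Filter.Eventually.of_forall fun x => (exp_pos _).le

theorem gauss_int_lin {V : Type*} [NormedAddCommGroup V] [InnerProductSpace ℝ V]
    [FiniteDimensional ℝ V] [MeasurableSpace V] [BorelSpace V] {b : ℝ} (hb : 0 < b) (w : V) :
    ∫⁻ v : V, ENNReal.ofReal (exp (-b * ‖v‖ ^ 2 + inner ℝ v w))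
      = ENNReal.ofReal (exp (‖w‖ ^ 2 / (4 * b))) *
        ENNReal.ofReal ((π / b) ^ (Module.finrank ℝ V / 2 : ℝ)) := by
  rw [← gauss_int hb, ← lintegral_const_mul _ (by fun_prop),
    ← lintegral_add_right_eq_self _ ((1 / (2 * b)) • w)]
  congr 1
  ext v
  rw [← ENNReal.ofReal_mul (exp_pos _).le, ← exp_add]
  congr 2
  rw [norm_add_sq_real, inner_add_left, inner_smul_left, inner_smul_right, norm_smul, mul_pow,
    Real.norm_eq_abs, sq_abs, real_inner_self_eq_norm_sq]
  simp only [RCLike.conj_to_real]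
  field_simp
  ring

theorem scale_int (n : ℕ) {s : ℝ} (hs : 0 < s) (F : (EE n) → ENNReal) (hF : Measurable F) :
    ENNReal.ofReal (s ^ n) * ∫⁻ x, F (s • x) = ∫⁻ x, F x := by
  have h := Measure.map_addHaar_smul (volume : Measure (EE n)) hs.ne'
  have h2 : ∫⁻ x, F (s • x) = ∫⁻ x, F x ∂(Measure.map (s • ·) volume) := by
    rw [lintegral_map hF (measurable_const_smul s)]
  rw [h2, h, lintegral_smul_measure, finrank_euclideanSpace_fin, smul_eq_mul, ← mul_assoc,
    ← ENNReal.ofReal_mul (by positivity), abs_of_pos (by positivity), mul_inv_cancel₀ (by positivity)]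
  simp

/-- unnormalized Gaussian weight -/
noncomputable def gw {n : ℕ} (x : EE n) : ENNReal := ENNReal.ofReal (exp (-‖x‖ ^ 2 / 2))
/-- normalizing constant -/
noncomputable def gz (n : ℕ) : ENNReal := ENNReal.ofReal ((2 * π) ^ (-(n : ℝ) / 2))

theorem measurable_gw {n : ℕ} : Measurable (gw (n := n)) := by unfold gw; fun_prop

theorem gz_ne_zero (n : ℕ) : gz n ≠ 0 := by
  unfold gz
  have : 0 < (2 * π) ^ (-(n : ℝ) / 2) := by positivity
  simpa using this

theorem gz_ne_top (n : ℕ) : gz n ≠ ⊤ := ENNReal.ofReal_ne_top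

theorem lint_gauss (n : ℕ) {f : (EE n) → ENNReal} (hf : Measurable f) :
    ∫⁻ x, f x ∂(stdGaussian n) = gz n * ∫⁻ x, gw x * f x := by
  unfold _root_.stdGaussian
  rw [lintegral_withDensity_eq_lintegral_mul _ (by fun_prop) hf,
    ← lintegral_const_mul (f := fun x => gw x * f x) _ (measurable_gw.mul hf)]
  congr 1; ext x
  simp only [Pi.mul_apply, gw, gz]
  rw [ENNReal.ofReal_mul (by positivity), mul_assoc]

instance stdGaussian_prob (n : ℕ) : IsProbabilityMeasure (stdGaussian n) := by
  constructor
  have h := lint_gauss n (f := fun _ => 1) measurable_const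
  rw [lintegral_one] at h
  rw [h]
  have h2 := gauss_int (V := EE n) (b := 1/2) (by norm_num)
  have : ∀ x : EE n, gw x * 1 = ENNReal.ofReal (exp (-(1/2) * ‖x‖ ^ 2)) := by
    intro x; rw [mul_one, gw]; congr 2; ring
  simp only [this]
  rw [h2, gz, ← ENNReal.ofReal_mul (by positivity), finrank_euclideanSpace_fin]
  rw [show π / (1/2) = 2 * π by ring, ← rpow_add (by positivity)]
  simp [neg_div]

theorem gw_rpow {n : ℕ} {l m : ℝ} (hlm : l + m = 1) (x y : EE n) :
    gw x ^ l * gw y ^ m * ENNReal.ofReal (exp (l * m * ‖x - y‖ ^ 2 / 2)) = gw (l • x + m • y) := by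
  unfold gw
  rw [ENNReal.ofReal_rpow_of_pos (exp_pos _), ENNReal.ofReal_rpow_of_pos (exp_pos _),
    ← exp_mul, ← exp_mul, ← ENNReal.ofReal_mul (exp_pos _).le, ← ENNReal.ofReal_mul (by positivity),
    ← exp_add, ← exp_add]
  congr 2
  rw [norm_sub_sq_real, norm_add_sq_real, norm_smul, norm_smul, inner_smul_left, inner_smul_right,
    mul_pow, mul_pow]
  simp only [Real.norm_eq_abs, sq_abs, RCLike.conj_to_real]
  obtain rfl : m = 1 - l := by linarith
  ring

theorem pl_gauss {l m : ℝ} (hl : 0 < l) (hm : 0 < m) (hlm : l + m = 1)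
    (n : ℕ) {f g h : (EE n) → ENNReal}
    (hf : Measurable f) (hg : Measurable g) (hh : Measurable h)
    (H : ∀ x y, f x ^ l * g y ^ m ≤
      h (l • x + m • y) * ENNReal.ofReal (exp (l * m * ‖x - y‖ ^ 2 / 2))) :
    (∫⁻ x, f x ∂(stdGaussian n)) ^ l * (∫⁻ x, g x ∂(stdGaussian n)) ^ m ≤
      ∫⁻ x, h x ∂(stdGaussian n) := by
  have key := pl_euc hl hm hlm n (measurable_gw.mul hf) (measurable_gw.mul hg)
    (measurable_gw.mul hh) (by
      intro x y
      simp only [Pi.mul_apply]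
      rw [ENNReal.mul_rpow_of_nonneg _ _ hl.le, ENNReal.mul_rpow_of_nonneg _ _ hm.le,
        mul_mul_mul_comm, ← gw_rpow hlm x y]
      rw [mul_assoc (gw x ^ l * gw y ^ m)]
      exact mul_le_mul_right ((H x y).trans (le_of_eq (mul_comm _ _))) _)
  rw [lint_gauss n hf, lint_gauss n hg, lint_gauss n hh]
  simp only [Pi.mul_apply] at key
  rw [ENNReal.mul_rpow_of_nonneg _ _ hl.le, ENNReal.mul_rpow_of_nonneg _ _ hm.le,
    mul_mul_mul_comm, ← ENNReal.rpow_add_of_nonneg _ _ hl.le hm.le, hlm, ENNReal.rpow_one]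
  gcongr

open scoped Pointwise

theorem mgf_eq (n : ℕ) {q : ℝ} (hq : q < 1) {K : Set (EE n)} (hK : MeasurableSet K) :
    ∫⁻ x in K, ENNReal.ofReal (exp (q * ‖x‖ ^ 2 / 2)) ∂(stdGaussian n) =
      ENNReal.ofReal ((1 - q) ^ (-(n : ℝ) / 2)) * stdGaussian n (√(1 - q) • K) := by
  have hs : 0 < √(1 - q) := by rw [Real.sqrt_pos]; linarith
  have hsK := hK.const_smul₀ (√(1 - q))
  have m1 : Measurable ((√(1 - q) • K).indicator (1 : (EE n) → ENNReal)) := by measurability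
  rw [← lintegral_indicator hK, lint_gauss n (by measurability), ← lintegral_indicator_one hsK,
    lint_gauss n m1, ← scale_int n hs (fun x => gw x * (√(1 - q) • K).indicator 1 x)
      (measurable_gw.mul m1), ← mul_assoc, mul_comm _ (gz n),
      mul_assoc, ← mul_assoc (ENNReal.ofReal _) (ENNReal.ofReal _)]
  congr 1
  have h1 : ENNReal.ofReal ((1 - q) ^ (-(n : ℝ) / 2)) * ENNReal.ofReal (√(1 - q) ^ n) = 1 := by
    rw [← ENNReal.ofReal_mul (by have : 0 < 1 - q := by linarith
                                 positivity), Real.sqrt_eq_rpow, ← rpow_natCast, ← rpow_mul (by linarith),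
      ← rpow_add (by linarith)]
    have : -(n:ℝ)/2 + 1/2*n = 0 := by ring
    rw [this]; simp
  rw [h1, one_mul]
  congr 1; ext x
  by_cases hx : x ∈ K
  · have hx' : √(1 - q) • x ∈ √(1 - q) • K := Set.smul_mem_smul_set hx
    simp only [hx, hx', Set.indicator_of_mem, Pi.one_apply, mul_one, gw]
    rw [← ENNReal.ofReal_mul (exp_pos _).le, ← exp_add, norm_smul, mul_pow, Real.norm_eq_abs, sq_abs,
      Real.sq_sqrt (by linarith)]
    congr 2; ring
  · have hx' : √(1 - q) • x ∉ √(1 - q) • K := by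
      rwa [Set.smul_mem_smul_set_iff₀ hs.ne']
    simp [hx, hx']

theorem conc (n : ℕ) {K : Set (EE n)} (hc : Convex ℝ K) (hK : MeasurableSet K)
    {s t l m : ℝ} (hs0 : 0 < s) (ht : 0 < t) (hl : 0 < l) (hm : 0 < m) (hlm : l + m = 1)
    (hst : l * s + m * t = 1) :
    stdGaussian n (s • K) ^ l * stdGaussian n (t • K) ^ m ≤ stdGaussian n K := by
  have hsK := hK.const_smul₀ s
  have htK := hK.const_smul₀ t
  have m1 : ∀ A : Set (EE n), MeasurableSet A → Measurable (A.indicator (1 : (EE n) → ENNReal)) :=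
    fun A hA => measurable_one.indicator hA
  have := pl_gauss (n := n) hl hm hlm (f := (s • K).indicator 1) (g := (t • K).indicator 1)
    (h := K.indicator 1) (m1 _ hsK) (m1 _ htK) (m1 _ hK) (by
      intro x y
      by_cases hx : x ∈ s • K
      · by_cases hy : y ∈ t • K
        · have : l • x + m • y ∈ K := by
            obtain ⟨x, hx, rfl⟩ := hx
            obtain ⟨y, hy, rfl⟩ := hy
            simp only [smul_smul]
            exact hc hx hy (by positivity) (by positivity) hst
          simp only [hx, hy, this, Set.indicator_of_mem, Pi.one_apply, ENNReal.one_rpow, one_mul]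
          rw [ENNReal.one_le_ofReal, Real.one_le_exp_iff]
          positivity
        · simp [hy, hm]
      · simp [hx, hl])
  rwa [lintegral_indicator_one hsK, lintegral_indicator_one htK, lintegral_indicator_one hK] at this

theorem maurey (n : ℕ) {K : Set (EE n)} (hc : Convex ℝ K) (hK : MeasurableSet K)
    {r t : ℝ} (hr : 0 ≤ r) (hball : Metric.ball 0 r ⊆ K) (ht : 1 < t) :
    stdGaussian n K * (ENNReal.ofReal (exp (((t - 1) * r) ^ 2 / 4)) * stdGaussian n (t • K)ᶜ) ≤ 1 := by
  have htK := (hK.const_smul₀ t).compl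
  have := pl_gauss (n := n) (l := 1/2) (m := 1/2) (by norm_num) (by norm_num) (by norm_num)
    (f := K.indicator 1)
    (g := ((t • K)ᶜ).indicator (fun _ => ENNReal.ofReal (exp (((t - 1) * r) ^ 2 / 4))))
    (h := fun _ => 1) (by measurability) (by measurability) (by measurability) (by
      intro x y
      by_cases hx : x ∈ K
      · by_cases hy : y ∈ (t • K)ᶜ
        · have hn : (t - 1) * r ≤ ‖x - y‖ := by
            by_contra hcon
            push Not at hcon
            apply hy
            have ht1 : 0 < t - 1 := by linarith
            have hz : (t - 1)⁻¹ • (y - x) ∈ K := by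
              apply hball
              rw [mem_ball_zero_iff, norm_smul, norm_inv, Real.norm_eq_abs, abs_of_pos ht1,
                norm_sub_rev, inv_mul_lt_iff₀ ht1]
              exact hcon
            refine ⟨(1/t) • x + ((t-1)/t) • ((t - 1)⁻¹ • (y - x)), hc hx hz (by positivity)
              (by positivity) (by field_simp; ring), ?_⟩
            have ht0 : t ≠ 0 := by linarith
            simp only [smul_add, smul_smul]
            rw [show t * (1 / t) = 1 by field_simp, show t * ((t - 1) / t * (t - 1)⁻¹) = 1 by field_simp]
            simp
          simp only [hx, hy, Set.indicator_of_mem, Pi.one_apply, ENNReal.one_rpow, one_mul]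
          rw [ENNReal.ofReal_rpow_of_pos (exp_pos _), ← exp_mul]
          apply ENNReal.ofReal_le_ofReal
          apply exp_le_exp.2
          have : ((t - 1) * r) ^ 2 ≤ ‖x - y‖ ^ 2 := by
            have : 0 ≤ (t - 1) * r := mul_nonneg (by linarith) hr
            gcongr
          nlinarith
        · simp [hy]
      · simp [hx])
  rw [lintegral_indicator_one hK, lintegral_indicator_const htK, lintegral_one, measure_univ,
    ← ENNReal.mul_rpow_of_nonneg _ _ (by norm_num)] at this
  have h2 := ENNReal.rpow_le_rpow this (show (0:ℝ) ≤ 2 by norm_num)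
  rw [← ENNReal.rpow_mul, ENNReal.one_rpow] at h2
  norm_num at h2
  exact h2

theorem subgauss (n : ℕ) {K : Set (EE n)} (hc : Convex ℝ K) (hsym : ∀ x ∈ K, -x ∈ K)
    (hK : MeasurableSet K) (θ : EE n) :
    ∫⁻ x in K, ENNReal.ofReal (exp (inner ℝ θ x)) ∂(stdGaussian n) ≤
      ENNReal.ofReal (exp (‖θ‖ ^ 2 / 2)) * stdGaussian n K := by
  have := pl_gauss (n := n) (l := 1/2) (m := 1/2) (by norm_num) (by norm_num) (by norm_num)
    (f := K.indicator fun x => ENNReal.ofReal (exp (inner ℝ θ x)))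
    (g := K.indicator fun x => ENNReal.ofReal (exp (inner ℝ θ (-x))))
    (h := K.indicator fun _ => ENNReal.ofReal (exp (‖θ‖ ^ 2 / 2)))
    (Measurable.indicator (by fun_prop) hK) (Measurable.indicator (by fun_prop) hK)
    (by measurability) (by
      intro x y
      by_cases hx : x ∈ K
      · by_cases hy : y ∈ K
        · have hz : (1/2:ℝ) • x + (1/2:ℝ) • y ∈ K :=
            hc hx hy (by norm_num) (by norm_num) (by norm_num)
          simp only [hx, hy, hz, Set.indicator_of_mem]
          rw [ENNReal.ofReal_rpow_of_pos (exp_pos _), ENNReal.ofReal_rpow_of_pos (exp_pos _),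
            ← exp_mul, ← exp_mul, ← ENNReal.ofReal_mul (exp_pos _).le,
            ← ENNReal.ofReal_mul (exp_pos _).le, ← exp_add, ← exp_add]
          apply ENNReal.ofReal_le_ofReal
          apply exp_le_exp.2
          have h1 : inner ℝ θ x * (1/2) + inner ℝ θ (-y) * (1/2) = (1/2) * inner ℝ θ (x - y) := by
            rw [inner_neg_right, inner_sub_right]; ring
          rw [h1]
          have := real_inner_le_norm θ (x - y)
          nlinarith [sq_nonneg (‖θ‖ - ‖x - y‖ / 2)]
        · simp [hy]
      · simp [hx])
  have hs : ∫⁻ x, K.indicator (fun x => ENNReal.ofReal (exp (inner ℝ θ (-x)))) x ∂(stdGaussian n)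
      = ∫⁻ x, K.indicator (fun x => ENNReal.ofReal (exp (inner ℝ θ x))) x ∂(stdGaussian n) := by
    rw [lint_gauss n (Measurable.indicator (by fun_prop) hK),
      lint_gauss n (Measurable.indicator (by fun_prop) hK)]
    congr 1
    rw [← lintegral_neg_eq_self]
    congr 1; ext x
    by_cases hx : x ∈ K
    · simp [hx, hsym x hx, gw]
    · have : -x ∉ K := fun h => hx (by simpa using hsym _ h)
      simp [hx, this]
  rw [hs, ← ENNReal.rpow_add_of_nonneg _ _ (by norm_num) (by norm_num)] at this
  norm_num at this
  rwa [lintegral_indicator hK, lintegral_indicator_const hK] at this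

theorem rot (n : ℕ) {F : (EE n) × (EE n) → ENNReal} (hF : Measurable F) :
    ∫⁻ x, ∫⁻ y, F (x, y) = ∫⁻ b : EE n, ∫⁻ a : EE n,
      F ((√2)⁻¹ • b - (√2)⁻¹ • a, (√2)⁻¹ • b + (√2)⁻¹ • a) := by
  have h2 : 0 < √2 := by positivity
  calc ∫⁻ x, ∫⁻ y, F (x, y)
      = ∫⁻ x, ENNReal.ofReal (√2 ^ n) * ∫⁻ b : EE n, F (x, √2 • b - x) := by
        congr 1; ext x
        rw [scale_int n h2 (fun b => F (x, b - x)) (by fun_prop),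
          lintegral_sub_right_eq_self (fun y => F (x, y)) x]
    _ = ENNReal.ofReal (√2 ^ n) * ∫⁻ b : EE n, ∫⁻ x, F (x, √2 • b - x) := by
        rw [lintegral_const_mul' _ _ ENNReal.ofReal_ne_top, lintegral_lintegral_swap]
        exact Measurable.aemeasurable (by unfold Function.uncurry; fun_prop)
    _ = ENNReal.ofReal (√2 ^ n) * ∫⁻ b : EE n, ENNReal.ofReal ((√2)⁻¹ ^ n) *
          ∫⁻ a : EE n, F ((√2)⁻¹ • b - (√2)⁻¹ • a, (√2)⁻¹ • b + (√2)⁻¹ • a) := by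
        congr 2; ext b
        have hh := scale_int n (inv_pos.2 h2)
          (fun z => F ((√2)⁻¹ • b - z, (√2)⁻¹ • b + z)) (by fun_prop)
        rw [hh, ← lintegral_sub_left_eq_self (fun x => F (x, √2 • b - x)) ((√2)⁻¹ • b)]
        congr 1; ext z
        congr 2
        have : √2 • b = (√2)⁻¹ • b + (√2)⁻¹ • b := by
          rw [← add_smul]; congr 1; field_simp; norm_num
        rw [this]; abel
    _ = _ := by
        rw [lintegral_const_mul' _ _ ENNReal.ofReal_ne_top, ← mul_assoc,
          ← ENNReal.ofReal_mul (by positivity), ← mul_pow, mul_inv_cancel₀ h2.ne']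
        simp

theorem fernique (n : ℕ) {K : Set (EE n)} (hc : Convex ℝ K) (hsym : ∀ x ∈ K, -x ∈ K)
    (hK : MeasurableSet K) :
    stdGaussian n K * stdGaussian n ((1 + √2) • K)ᶜ ≤ stdGaussian n Kᶜ * stdGaussian n Kᶜ := by
  have htK := (hK.const_smul₀ (1 + √2)).compl
  have hKc := hK.compl
  have e : ∀ A B : Set (EE n), MeasurableSet A → MeasurableSet B →
      stdGaussian n A * stdGaussian n B = gz n * gz n *
        ∫⁻ x, ∫⁻ y, (gw x * A.indicator 1 x) * (gw y * B.indicator 1 y) := by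
    intro A B hA hB
    have mA : Measurable (A.indicator (1 : (EE n) → ENNReal)) := by measurability
    have mB : Measurable (B.indicator (1 : (EE n) → ENNReal)) := by measurability
    rw [← lintegral_indicator_one hA, ← lintegral_indicator_one hB, lint_gauss n mA, lint_gauss n mB,
      mul_mul_mul_comm]
    congr 1
    exact (lintegral_lintegral_mul (measurable_gw.mul mA).aemeasurable
      (measurable_gw.mul mB).aemeasurable).symm
  have mm : ∀ A : Set (EE n), MeasurableSet A →
      Measurable fun x => gw x * A.indicator (1 : (EE n) → ENNReal) x := by
    intro A hA
    exact measurable_gw.mul (by measurability)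
  rw [e _ _ hK htK, e _ _ hKc hKc]
  refine mul_le_mul_right ?_ _
  rw [rot n (F := fun p => (gw p.1 * K.indicator 1 p.1) * (gw p.2 * ((1 + √2) • K)ᶜ.indicator 1 p.2))
    (((mm _ hK).comp measurable_fst).mul ((mm _ htK).comp measurable_snd))]
  refine lintegral_mono fun b => lintegral_mono fun a => ?_
  simp only []
  set x := (√2)⁻¹ • b - (√2)⁻¹ • a with hx
  set y := (√2)⁻¹ • b + (√2)⁻¹ • a with hy
  by_cases hxK : x ∈ K
  swap
  · simp [hxK]
  by_cases hyK : y ∈ ((1 + √2) • K)ᶜ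
  swap
  · simp [hyK]
  have h2 : 0 < √2 := by positivity
  have comb : ∀ u ∈ K, ∀ v ∈ K, u + √2 • v ∈ (1 + √2) • K := by
    intro u hu v hv
    refine ⟨(1 / (1 + √2)) • u + (√2 / (1 + √2)) • v, hc hu hv (by positivity) (by positivity)
      (by field_simp), ?_⟩
    simp only [smul_add, smul_smul]
    congr 1
    · rw [show (1 + √2) * (1 / (1 + √2)) = 1 by field_simp, one_smul]
    · congr 1; field_simp
  have s2 : √2 = (√2)⁻¹ + (√2)⁻¹ := by field_simp; norm_num
  have hb : b ∈ Kᶜ := by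
    intro hb
    apply hyK
    have := comb _ (hsym _ hxK) _ hb
    rwa [show -x + √2 • b = y by
      rw [s2, add_smul, hx, hy]; abel] at this
  have ha : a ∈ Kᶜ := by
    intro ha
    apply hyK
    have := comb _ hxK _ ha
    rwa [show x + √2 • a = y by
      rw [s2, add_smul, hx, hy]; abel] at this
  simp only [hxK, hyK, ha, hb, Set.indicator_of_mem, Pi.one_apply, mul_one, gw]
  rw [← ENNReal.ofReal_mul (exp_pos _).le, ← ENNReal.ofReal_mul (exp_pos _).le, ← exp_add, ← exp_add]
  apply ENNReal.ofReal_le_ofReal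
  apply exp_le_exp.2
  have h1 : (√2)⁻¹ ^ 2 = 1/2 := by rw [inv_pow, Real.sq_sqrt (by norm_num)]; norm_num
  have hpar := parallelogram_law_with_norm ℝ ((√2)⁻¹ • b) ((√2)⁻¹ • a)
  rw [← hx, ← hy, norm_smul, norm_smul, Real.norm_eq_abs, abs_of_pos (inv_pos.2 h2)] at hpar
  nlinarith

theorem slab_aux (n : ℕ) {V : Type*} [NormedAddCommGroup V] [InnerProductSpace ℝ V]
    [FiniteDimensional ℝ V] [MeasurableSpace V] [BorelSpace V] (i : V →ₗᵢ[ℝ] (EE n))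
    (P : (EE n) →L[ℝ] V) (hP : ∀ v x, inner ℝ (i v) x = inner ℝ v (P x))
    {K : Set (EE n)} (hc : Convex ℝ K) (hsym : ∀ x ∈ K, -x ∈ K)
    (hK : MeasurableSet K) {q : ℝ} (hq0 : 0 < q) (hq : q < 1) :
    ∫⁻ x in K, ENNReal.ofReal (exp (q * ‖P x‖ ^ 2 / 2)) ∂(stdGaussian n) ≤
      ENNReal.ofReal ((1 - q) ^ (-(Module.finrank ℝ V : ℝ) / 2)) * stdGaussian n K := by
  have hb : 0 < 1 / (2 * q) := by positivity
  have hq1 : 0 < 1 - q := by linarith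
  set b := 1 / (2 * q) with hbdef
  have hb2 : 0 < b - 1/2 := by
    rw [hbdef, sub_pos, div_lt_div_iff₀ (by norm_num) (by positivity)]; linarith
  set c := ENNReal.ofReal ((π / b) ^ (Module.finrank ℝ V / 2 : ℝ)) with hcdef
  have hcpos : 0 < (π / b) ^ (Module.finrank ℝ V / 2 : ℝ) := by positivity
  have hc0 : c ≠ 0 := by simpa [hcdef] using hcpos
  have hct : c ≠ ⊤ := ENNReal.ofReal_ne_top
  have step : c * ∫⁻ x in K, ENNReal.ofReal (exp (q * ‖P x‖ ^ 2 / 2)) ∂(stdGaussian n) ≤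
      c * (ENNReal.ofReal ((1 - q) ^ (-(Module.finrank ℝ V : ℝ) / 2)) * stdGaussian n K) := by
    calc c * ∫⁻ x in K, ENNReal.ofReal (exp (q * ‖P x‖ ^ 2 / 2)) ∂(stdGaussian n)
        = ∫⁻ x in K, (∫⁻ v : V, ENNReal.ofReal (exp (-b * ‖v‖ ^ 2 + inner ℝ v (P x))))
            ∂(stdGaussian n) := by
          rw [← lintegral_const_mul' _ _ hct]
          congr 1; ext x
          rw [gauss_int_lin hb, mul_comm c]
          congr 3
          rw [hbdef]; field_simp
          ring
      _ = ∫⁻ v : V, (∫⁻ x in K, ENNReal.ofReal (exp (-b * ‖v‖ ^ 2 + inner ℝ v (P x)))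
            ∂(stdGaussian n)) := by
          rw [lintegral_lintegral_swap]
          refine Measurable.aemeasurable ?_
          unfold Function.uncurry
          exact ENNReal.measurable_ofReal.comp (Continuous.measurable (by fun_prop))
      _ ≤ ∫⁻ v : V, ENNReal.ofReal (exp (-(b - 1/2) * ‖v‖ ^ 2)) * stdGaussian n K := by
          refine lintegral_mono fun v => ?_
          calc _ = ENNReal.ofReal (exp (-b * ‖v‖ ^ 2)) *
                ∫⁻ x in K, ENNReal.ofReal (exp (inner ℝ (i v) x)) ∂(stdGaussian n) := by
                rw [← lintegral_const_mul' _ _ ENNReal.ofReal_ne_top]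
                congr 1; ext x
                rw [exp_add, ENNReal.ofReal_mul (exp_pos _).le, hP]
            _ ≤ ENNReal.ofReal (exp (-b * ‖v‖ ^ 2)) *
                (ENNReal.ofReal (exp (‖i v‖ ^ 2 / 2)) * stdGaussian n K) := by
                gcongr
                exact subgauss n hc hsym hK (i v)
            _ = _ := by
                rw [← mul_assoc, ← ENNReal.ofReal_mul (exp_pos _).le, ← exp_add, i.norm_map]
                congr 3; ring
      _ = ENNReal.ofReal ((π / (b - 1/2)) ^ (Module.finrank ℝ V / 2 : ℝ)) * stdGaussian n K := by
          rw [lintegral_mul_const _ (by fun_prop), gauss_int hb2]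
      _ = _ := by
          rw [← mul_assoc, hcdef, ← ENNReal.ofReal_mul (by positivity)]
          congr 2
          rw [neg_div, rpow_neg hq1.le, ← inv_rpow hq1.le, ← mul_rpow (by positivity) (by positivity)]
          congr 1
          have : 1 - q ≠ 0 := hq1.ne'
          rw [show b - 1/2 = (1 - q) / (2 * q) by rw [hbdef]; field_simp, hbdef]
          field_simp
  exact (ENNReal.mul_le_mul_iff_right hc0 hct).1 step

theorem slab (n : ℕ) {K : Set (EE n)} (hc : Convex ℝ K) (hsym : ∀ x ∈ K, -x ∈ K)
    (hK : MeasurableSet K) {q : ℝ} (hq0 : 0 < q) (hq : q < 1) (u : EE n) (hu : ‖u‖ = 1)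
    (hw : ∀ x ∈ K, inner ℝ u x ≤ √(1/2)) :
    ∫⁻ x in K, ENNReal.ofReal (exp (q * ‖x‖ ^ 2 / 2)) ∂(stdGaussian n) ≤
      ENNReal.ofReal ((1 - q) ^ (-(n : ℝ) / 2) * exp (-(q / 4))) * stdGaussian n K := by
  have hq1 : 0 < 1 - q := by linarith
  set V := (Submodule.span ℝ {u})ᗮ with hV
  have hfin : (Module.finrank ℝ V : ℝ) = n - 1 := by
    have h1 := Submodule.finrank_add_finrank_orthogonal (Submodule.span ℝ {u})
    rw [finrank_span_singleton (by intro h; simp [h] at hu), finrank_euclideanSpace_fin] at h1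
    have h2 : (1:ℝ) + Module.finrank ℝ V = n := by exact_mod_cast h1
    linarith
  have key := slab_aux n V.subtypeₗᵢ V.orthogonalProjectionOnto (by
    intro v x
    simp) hc hsym hK hq0 hq
  have hpt : ∀ x ∈ K, ENNReal.ofReal (exp (q * ‖x‖ ^ 2 / 2)) ≤
      ENNReal.ofReal (exp (q / 4)) * ENNReal.ofReal (exp (q * ‖V.orthogonalProjectionOnto x‖ ^ 2 / 2)) := by
    intro x hx
    rw [← ENNReal.ofReal_mul (exp_pos _).le, ← exp_add]
    apply ENNReal.ofReal_le_ofReal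
    apply exp_le_exp.2
    have h1 := Submodule.norm_sq_eq_add_norm_sq_projection x (Submodule.span ℝ {u})
    have h2 : ‖(Submodule.span ℝ {u}).orthogonalProjectionOnto x‖ ^ 2 = (inner ℝ u x) ^ 2 := by
      have := Submodule.starProjection_unit_singleton ℝ hu x
      rw [Submodule.starProjection_apply] at this
      rw [Submodule.coe_norm, this, norm_smul, hu, mul_one, Real.norm_eq_abs, sq_abs]
    have h3 : (inner ℝ u x) ^ 2 ≤ (1/2 : ℝ) := by
      have ha := hw x hx
      have hb := hw _ (hsym x hx)
      rw [inner_neg_right] at hb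
      have : |inner ℝ u x| ≤ √(1/2) := abs_le.2 ⟨by linarith, ha⟩
      rw [← sq_abs]
      calc _ ≤ √(1/2) ^ 2 := by gcongr
        _ = _ := Real.sq_sqrt (by norm_num)
    rw [h2] at h1
    nlinarith
  calc _ ≤ ∫⁻ x in K, ENNReal.ofReal (exp (q / 4)) *
        ENNReal.ofReal (exp (q * ‖V.orthogonalProjectionOnto x‖ ^ 2 / 2)) ∂(stdGaussian n) :=
        setLIntegral_mono' hK hpt
    _ = ENNReal.ofReal (exp (q / 4)) * ∫⁻ x in K,
        ENNReal.ofReal (exp (q * ‖V.orthogonalProjectionOnto x‖ ^ 2 / 2)) ∂(stdGaussian n) :=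
        lintegral_const_mul' _ _ ENNReal.ofReal_ne_top
    _ ≤ ENNReal.ofReal (exp (q / 4)) *
        (ENNReal.ofReal ((1 - q) ^ (-(Module.finrank ℝ V : ℝ) / 2)) * stdGaussian n K) := by gcongr
    _ ≤ _ := by
        rw [← mul_assoc, ← ENNReal.ofReal_mul (exp_pos _).le]
        refine mul_le_mul' (ENNReal.ofReal_le_ofReal ?_) le_rfl
        rw [hfin, show -((n:ℝ) - 1) / 2 = -(n:ℝ)/2 + 1/2 by ring, rpow_add hq1]
        have h1 : (1 - q) ^ (1/2 : ℝ) ≤ exp (-(q/2)) := by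
          calc (1 - q) ^ (1/2 : ℝ) ≤ (exp (-q)) ^ (1/2 : ℝ) := by
                apply rpow_le_rpow hq1.le _ (by norm_num)
                have := add_one_le_exp (-q); linarith
            _ = _ := by rw [← exp_mul]; congr 1; ring
        calc exp (q/4) * ((1 - q) ^ (-(n:ℝ)/2) * (1 - q) ^ (1/2 : ℝ))
            ≤ exp (q/4) * ((1 - q) ^ (-(n:ℝ)/2) * exp (-(q/2))) := by gcongr
          _ = (1 - q) ^ (-(n:ℝ)/2) * (exp (q/4) * exp (-(q/2))) := by ring
          _ = _ := by rw [← exp_add]; congr 2; ring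

/-- consequence of log-concavity of `t ↦ γ(tK)` -/
theorem conc_use (n : ℕ) {K : Set (EE n)} (hc : Convex ℝ K) (hK : MeasurableSet K)
    {s t k : ℝ} (hs0 : 0 < s) (hs : s < 1) (ht : 1 < t)
    (hp : 0 < (stdGaussian n).real K)
    (h : (stdGaussian n).real K ≤ exp (-(k * (t - 1))) * (stdGaussian n).real (t • K)) :
    (stdGaussian n).real (s • K) ≤ exp (-(k * (1 - s))) * (stdGaussian n).real K := by
  have hts : 0 < t - s := by linarith
  obtain ⟨l, hl'⟩ : ∃ l, l = (t - 1) / (t - s) := ⟨_, rfl⟩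
  obtain ⟨m, hm'⟩ : ∃ m, m = (1 - s) / (t - s) := ⟨_, rfl⟩
  have hl : 0 < l := hl' ▸ div_pos (by linarith) hts
  have hm : 0 < m := hm' ▸ div_pos (by linarith) hts
  have hlm : l + m = 1 := by rw [hl', hm']; field_simp; ring
  have hst : l * s + m * t = 1 := by rw [hl', hm']; field_simp; ring
  have hlm2 : (t - 1) * m = (1 - s) * l := by rw [hl', hm']; field_simp
  have key := conc n hc hK hs0 (by linarith : 0 < t) hl hm hlm hst
  have key2 := ENNReal.toReal_mono (measure_ne_top _ _) key
  rw [ENNReal.toReal_mul, ← ENNReal.toReal_rpow, ← ENNReal.toReal_rpow] at key2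
  change (stdGaussian n).real (s • K) ^ l * (stdGaussian n).real (t • K) ^ m ≤
    (stdGaussian n).real K at key2
  set p := (stdGaussian n).real K
  set a := (stdGaussian n).real (s • K) with ha
  set b := (stdGaussian n).real (t • K)
  have ha0 : 0 ≤ a := measureReal_nonneg
  have hbp : p * exp (k * (t - 1)) ≤ b := by
    rw [exp_neg] at h
    have h3 := exp_pos (k * (t - 1))
    rwa [inv_mul_eq_div, le_div_iff₀ h3] at h
  have h4 : a ^ l * (p * exp (k * (t - 1))) ^ m ≤ p :=
    le_trans (by gcongr) key2
  have h5 : a ^ l ≤ (exp (-(k * (1 - s))) * p) ^ l := by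
    rw [mul_rpow (exp_pos _).le hp.le, ← exp_mul]
    rw [mul_rpow hp.le (exp_pos _).le, ← exp_mul] at h4
    have h6 : p = p ^ l * p ^ m := by rw [← rpow_add hp, hlm, rpow_one]
    have h7 : a ^ l * exp (k * (t - 1) * m) * p ^ m ≤ p ^ l * p ^ m := by
      rw [← h6]; linarith
    have h8 := le_of_mul_le_mul_right h7 (by positivity)
    have h9 : exp (-(k * (1 - s)) * l) = (exp (k * (t - 1) * m))⁻¹ := by
      rw [← exp_neg]; congr 1; linear_combination (k : ℝ) * hlm2
    rw [h9, inv_mul_eq_div, le_div_iff₀ (exp_pos _)]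
    exact h8
  exact (rpow_le_rpow_iff ha0 (by positivity) hl).1 h5

theorem ball_subset_of_not_slab (n : ℕ) {K : Set (EE n)} (hc : Convex ℝ K) (hp : 0 < (stdGaussian n).real K)
    {r : ℝ} (H : ¬ ∃ u : EE n, ‖u‖ = 1 ∧ ∀ x ∈ K, inner ℝ u x ≤ r) :
    Metric.ball 0 r ⊆ K := by
  have hint : (interior K).Nonempty := by
    by_contra hne
    rw [Set.not_nonempty_iff_eq_empty] at hne
    have h1 : volume K = 0 := by
      refine measure_mono_null ?_ (hc.addHaar_frontier volume)
      rw [frontier, hne, Set.sdiff_empty]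
      exact subset_closure
    have h2 : stdGaussian n K = 0 := withDensity_absolutelyContinuous _ _ h1
    simp [Measure.real, h2] at hp
  have hcl : Metric.ball 0 r ⊆ closure K := by
    intro y hy
    by_contra hyc
    obtain ⟨f, a, hfa, hay⟩ := geometric_hahn_banach_closed_point hc.closure isClosed_closure hyc
    apply H
    set w := (InnerProductSpace.toDual ℝ (EE n)).symm f with hw
    have hfw : ∀ x, f x = inner ℝ w x := fun x => by
      rw [hw, InnerProductSpace.toDual_symm_apply]
    obtain ⟨z, hz⟩ := hint
    have hzK := interior_subset hz
    have hw0 : w ≠ 0 := by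
      intro h0
      have h1 := hfa z (subset_closure hzK)
      rw [hfw, h0, inner_zero_left] at h1
      rw [hfw, h0, inner_zero_left] at hay
      linarith
    have hwn : 0 < ‖w‖ := norm_pos_iff.2 hw0
    refine ⟨‖w‖⁻¹ • w, by rw [norm_smul, norm_inv, norm_norm, inv_mul_cancel₀ hwn.ne'], ?_⟩
    intro x hx
    have h1 := hfa x (subset_closure hx)
    rw [hfw] at h1 hay
    have h2 := real_inner_le_norm w y
    rw [mem_ball_zero_iff] at hy
    rw [inner_smul_left, RCLike.conj_to_real, inv_mul_le_iff₀ hwn]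
    nlinarith
  calc Metric.ball 0 r ⊆ interior (closure K) := interior_maximal hcl Metric.isOpen_ball
    _ = interior K := hc.interior_closure_eq_interior_of_nonempty_interior hint
    _ ⊆ K := interior_subset

theorem real_compl (n : ℕ) {A : Set (EE n)} (hA : MeasurableSet A) :
    (stdGaussian n).real Aᶜ = 1 - (stdGaussian n).real A := probReal_compl_eq_one_sub hA

theorem growth_big (n : ℕ) {K : Set (EE n)} (hc : Convex ℝ K) (hsym : ∀ x ∈ K, -x ∈ K)
    (hK : MeasurableSet K) {ε : ℝ} (hε : 0 < ε)
    (hp : 3/5 ≤ (stdGaussian n).real K) (hpε : (stdGaussian n).real K ≤ 1 - ε) :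
    (stdGaussian n).real K ≤
      exp (-(ε / 50 * ((1 + √2) - 1))) * (stdGaussian n).real ((1 + √2) • K) := by
  have h := ENNReal.toReal_mono (ENNReal.mul_ne_top (measure_ne_top _ _) (measure_ne_top _ _))
    (fernique n hc hsym hK)
  rw [ENNReal.toReal_mul, ENNReal.toReal_mul] at h
  change (stdGaussian n).real K * (stdGaussian n).real ((1 + √2) • K)ᶜ ≤
    (stdGaussian n).real Kᶜ * (stdGaussian n).real Kᶜ at h
  rw [real_compl n hK, real_compl n (hK.const_smul₀ _)] at h
  set p := (stdGaussian n).real K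
  set b := (stdGaussian n).real ((1 + √2) • K) with hb
  have hb0 : 0 ≤ b := measureReal_nonneg
  have hs2 : √2 ≤ 3/2 := Real.sqrt_le_iff.2 ⟨by norm_num, by norm_num⟩
  have h1 : 1 - b ≤ 2/3 * (1 - p) := by
    by_contra hcon
    push Not at hcon
    nlinarith
  have h2 : 1 - ε / 30 ≤ exp (-(ε / 50 * ((1 + √2) - 1))) := by
    have := add_one_le_exp (-(ε / 50 * ((1 + √2) - 1)))
    nlinarith
  have h3 : p ≤ (1 - ε / 30) * b := by nlinarith
  exact h3.trans (by gcongr)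

theorem growth_small (n : ℕ) {K : Set (EE n)} (hc : Convex ℝ K)
    (hK : MeasurableSet K) {ε : ℝ} (hε : 0 < ε) (hε1 : ε < 1)
    (hp0 : 0 < (stdGaussian n).real K) (hp : (stdGaussian n).real K < 3/5)
    (hball : Metric.ball 0 (√(1/2)) ⊆ K) :
    ∃ t > 1, (stdGaussian n).real K ≤
      exp (-(ε / 50 * (t - 1))) * (stdGaussian n).real (t • K) := by
  set p := (stdGaussian n).real K with hpdef
  have hlog : 0 < log (4 / p) := log_pos (by rw [lt_div_iff₀ hp0]; linarith)
  obtain ⟨τ, hτ⟩ : ∃ τ, τ = √(8 * log (4 / p)) := ⟨_, rfl⟩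
  have hτ0 : 0 < τ := by rw [hτ]; positivity
  have hτ2 : τ ^ 2 / 8 = log (4 / p) := by
    rw [hτ, Real.sq_sqrt (by positivity)]; ring
  have hexp : exp (τ ^ 2 / 8) = 4 / p := by rw [hτ2, exp_log (by positivity)]
  refine ⟨1 + τ, by linarith, ?_⟩
  have h := ENNReal.toReal_mono ENNReal.one_ne_top
    (maurey n hc hK (r := √(1/2)) (t := 1 + τ) (by positivity) hball (by linarith))
  rw [ENNReal.toReal_mul, ENNReal.toReal_mul, ENNReal.toReal_ofReal (exp_pos _).le,
    ENNReal.toReal_one] at h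
  change p * (_ * (stdGaussian n).real ((1 + τ) • K)ᶜ) ≤ 1 at h
  rw [real_compl n (hK.const_smul₀ _)] at h
  set b := (stdGaussian n).real ((1 + τ) • K) with hb
  have hr : ((1 + τ - 1) * √(1/2)) ^ 2 / 4 = τ ^ 2 / 8 := by
    rw [mul_pow, Real.sq_sqrt (by norm_num)]; ring
  rw [hr, hexp, ← mul_assoc, mul_div_cancel₀ _ hp0.ne'] at h
  have hb1 : 3/4 ≤ b := by linarith
  have hmain : p ≤ exp (-(τ / 50)) * (3/4) := by
    rcases le_total τ 10 with h10 | h10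
    · have := add_one_le_exp (-(τ / 50))
      linarith
    · have hp' : p = 4 * exp (-(τ ^ 2 / 8)) := by
        rw [exp_neg, hexp]; field_simp
      have h1 : exp (-(τ^2/8)) ≤ exp (-(τ / 50) + -12) := by
        apply exp_le_exp.2; nlinarith
      rw [exp_add] at h1
      have h2 : exp (-12) ≤ 1/13 := by
        rw [exp_neg, ← one_div]
        apply one_div_le_one_div_of_le (by norm_num)
        have := add_one_le_exp (12:ℝ); linarith
      have h3 := exp_pos (-(τ/50))
      nlinarith
  have h4 : exp (-(τ / 50)) ≤ exp (-(ε / 50 * (1 + τ - 1))) := by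
    apply exp_le_exp.2; nlinarith
  have h5 := exp_pos (-(τ/50))
  calc p ≤ exp (-(τ / 50)) * (3/4) := hmain
    _ ≤ _ := by gcongr

theorem mgf_bound (n : ℕ) {K : Set (EE n)} (hc : Convex ℝ K) (hsym : ∀ x ∈ K, -x ∈ K)
    (hK : MeasurableSet K) {ε : ℝ} (hε : 0 < ε) (hε1 : ε < 1)
    (hp0 : 0 < (stdGaussian n).real K) (hpε : (stdGaussian n).real K ≤ 1 - ε)
    {q : ℝ} (hq0 : 0 < q) (hq : q < 1) :
    ∫⁻ x in K, ENNReal.ofReal (exp (q * ‖x‖ ^ 2 / 2)) ∂(stdGaussian n) ≤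
      ENNReal.ofReal ((1 - q) ^ (-(n : ℝ) / 2) * exp (-(ε * q / 100))) * stdGaussian n K := by
  have hq1 : 0 < 1 - q := by linarith
  by_cases H : ∃ u : EE n, ‖u‖ = 1 ∧ ∀ x ∈ K, inner ℝ u x ≤ √(1/2)
  · obtain ⟨u, hu, hw⟩ := H
    refine (slab n hc hsym hK hq0 hq u hu hw).trans ?_
    exact mul_le_mul' (ENNReal.ofReal_le_ofReal (mul_le_mul_of_nonneg_left
      (exp_le_exp.2 (by nlinarith)) (by positivity))) le_rfl
  have hball := ball_subset_of_not_slab n hc hp0 H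
  obtain ⟨t, ht, hgr⟩ : ∃ t > 1, (stdGaussian n).real K ≤
      exp (-(ε / 50 * (t - 1))) * (stdGaussian n).real (t • K) := by
    by_cases hp : 3/5 ≤ (stdGaussian n).real K
    · refine ⟨1 + √2, ?_, growth_big n hc hsym hK hε hp hpε⟩
      have : 0 < √2 := by positivity
      linarith
    · exact growth_small n hc hK hε hε1 hp0 (not_le.1 hp) hball
  have hs0 : 0 < √(1 - q) := by positivity
  have hs1 : √(1 - q) ≤ 1 - q / 2 := Real.sqrt_le_iff.2 ⟨by linarith, by nlinarith⟩
  have key := conc_use n hc hK hs0 (by linarith) ht hp0 hgr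
  rw [mgf_eq n hq hK, ENNReal.ofReal_mul (by positivity), mul_assoc]
  gcongr
  have h2 : (stdGaussian n).real (√(1 - q) • K) ≤ exp (-(ε * q / 100)) * (stdGaussian n).real K := by
    refine key.trans ?_
    gcongr
    nlinarith
  have h3 := ENNReal.ofReal_le_ofReal h2
  rwa [ENNReal.ofReal_mul (exp_pos _).le, ofReal_measureReal, ofReal_measureReal] at h3

theorem lintegral_pi_prod {α : Type*} [MeasurableSpace α] (μ : Measure α) [SigmaFinite μ]
    {f : α → ENNReal} (hf : Measurable f) (T : ℕ) :
    ∫⁻ x, ∏ i, f (x i) ∂(Measure.pi fun _ : Fin T => μ) = (∫⁻ x, f x ∂μ) ^ T := by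
  induction T with
  | zero => simp
  | succ T ih =>
    have hmp := measurePreserving_piFinSuccAbove (fun _ : Fin (T + 1) => μ) 0
    have h1 := hmp.lintegral_comp (f := fun z => f z.1 * ∏ i, f (z.2 i)) (by fun_prop)
    have h2 : ∀ x : Fin (T + 1) → α, ∏ i, f (x i) =
        f ((MeasurableEquiv.piFinSuccAbove (fun _ => α) 0 x).1) *
        ∏ i, f ((MeasurableEquiv.piFinSuccAbove (fun _ => α) 0 x).2 i) := by
      intro x
      rw [Fin.prod_univ_succ]
      rfl
    simp only [h2]
    rw [h1, lintegral_prod_mul (g := fun y : Fin T → α => ∏ i, f (y i)) hf.aemeasurable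
      (Measurable.aemeasurable (by fun_prop)), ih, pow_succ']

theorem chernoff {n : ℕ} (μ : Measure (EE n)) [IsFiniteMeasure μ] (T : ℕ) {F : (EE n) → ℝ}
    (hF : Measurable F) (A : ℝ) {S : Set (Fin T → EE n)} (hS : ∀ x ∈ S, A ≤ ∑ i, F (x i)) :
    (Measure.pi fun _ : Fin T => μ) S ≤
      ENNReal.ofReal (exp (-A)) * (∫⁻ x, ENNReal.ofReal (exp (F x)) ∂μ) ^ T := by
  have hprod : ∫⁻ x, ENNReal.ofReal (exp (∑ i, F (x i))) ∂(Measure.pi fun _ : Fin T => μ)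
      = (∫⁻ x, ENNReal.ofReal (exp (F x)) ∂μ) ^ T := by
    have : ∀ x : Fin T → EE n, ENNReal.ofReal (exp (∑ i, F (x i))) =
        ∏ i, ENNReal.ofReal (exp (F (x i))) := by
      intro x
      rw [exp_sum, ENNReal.ofReal_prod_of_nonneg fun i _ => (exp_pos _).le]
    simp only [this]
    exact lintegral_pi_prod μ (f := fun x => ENNReal.ofReal (exp (F x))) (by fun_prop) T
  have h1 := mul_meas_ge_le_lintegral (μ := Measure.pi fun _ : Fin T => μ)
    (f := fun x => ENNReal.ofReal (exp (∑ i, F (x i)))) (by fun_prop) (ENNReal.ofReal (exp A))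
  rw [hprod] at h1
  have h2 : (Measure.pi fun _ : Fin T => μ) S ≤ (Measure.pi fun _ : Fin T => μ)
      {x | ENNReal.ofReal (exp A) ≤ ENNReal.ofReal (exp (∑ i, F (x i)))} := by
    apply measure_mono
    intro x hx
    exact ENNReal.ofReal_le_ofReal (exp_le_exp.2 (hS x hx))
  calc (Measure.pi fun _ : Fin T => μ) S
      = ENNReal.ofReal (exp (-A)) * (ENNReal.ofReal (exp A) * (Measure.pi fun _ : Fin T => μ) S) := by
        rw [← mul_assoc, ← ENNReal.ofReal_mul (exp_pos _).le, ← exp_add]; simp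
    _ ≤ _ := by gcongr; exact (mul_le_mul_right h2 _).trans h1

theorem exp_num (x : ℝ) (hx : x ≤ -3) : ENNReal.ofReal (exp x) ≤ 1/10 := by
  have h : exp x ≤ 1/10 := by
    calc exp x ≤ exp (-3) := exp_le_exp.2 hx
      _ = (exp 1 ^ 3)⁻¹ := by rw [← exp_nat_mul, exp_neg]; norm_num
      _ ≤ (2.7 ^ 3)⁻¹ := by
        have := exp_one_gt_d9
        gcongr
        linarith
      _ ≤ 1/10 := by norm_num
  refine (ENNReal.ofReal_le_ofReal h).trans (le_of_eq ?_)
  rw [ENNReal.ofReal_div_of_pos (by norm_num)]; simp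

theorem final_num {n : ℕ} (μ : Measure (EE n)) [IsFiniteMeasure μ] (T : ℕ) {F : (EE n) → ℝ}
    (hF : Measurable F) (A β : ℝ) {S : Set (Fin T → EE n)} (hS : ∀ x ∈ S, A ≤ ∑ i, F (x i))
    (hβ : ∫⁻ x, ENNReal.ofReal (exp (F x)) ∂μ ≤ ENNReal.ofReal (exp β)) (h : -A + T * β ≤ -3) :
    (Measure.pi fun _ : Fin T => μ) S ≤ 1 / 10 := by
  refine (chernoff μ T hF A hS).trans ?_
  calc _ ≤ ENNReal.ofReal (exp (-A)) * (ENNReal.ofReal (exp β)) ^ T := by gcongr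
    _ = ENNReal.ofReal (exp (-A + T * β)) := by
      rw [← ENNReal.ofReal_pow (exp_pos _).le, ← ENNReal.ofReal_mul (exp_pos _).le, ← exp_nat_mul,
        ← exp_add]
    _ ≤ _ := exp_num _ h

/-- concentration of the average squared norm of `T ≥ C·n/ε²` i.i.d. samples,
both for the standard Gaussian and for the Gaussian truncated to a symmetric convex set of
volume at most `1 - ε`. -/
theorem symm_convex_distinguisher_correct :
    ∃ c C : ℝ, 0 < c ∧ 0 < C ∧
      ∀ (n : ℕ) (ε : ℝ) (T : ℕ), 0 < ε → ε < 1 → C * n / ε ^ 2 ≤ T →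
        ((Measure.pi fun _ : Fin T => stdGaussian n)
            {x | (1 / T : ℝ) * ∑ i, ‖x i‖ ^ 2 < n - c * ε / 2} ≤ 1 / 10) ∧
        (∀ K : Set (EuclideanSpace ℝ (Fin n)),
          Convex ℝ K → (∀ x ∈ K, -x ∈ K) → MeasurableSet K →
          0 < (stdGaussian n K).toReal → (stdGaussian n K).toReal ≤ 1 - ε →
          (Measure.pi fun _ : Fin T => truncGaussian n K)
            {x | (n : ℝ) - c * ε / 2 ≤ (1 / T : ℝ) * ∑ i, ‖x i‖ ^ 2} ≤ 1 / 10) := by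
  refine ⟨1/50, 480000, by norm_num, by norm_num, ?_⟩
  intro n ε T hε hε1 hT
  rcases Nat.eq_zero_or_pos n with hn | hn
  · subst hn
    refine ⟨?_, ?_⟩
    · have : {x : Fin T → EE 0 | (1 / T : ℝ) * ∑ i, ‖x i‖ ^ 2 < (0:ℕ) - 1/50 * ε / 2} = ∅ := by
        ext x
        have h1 : ∀ i, ‖x i‖ = 0 := fun i => by
          rw [Subsingleton.elim (x i) 0, norm_zero]
        simp only [h1, Set.mem_ofPred_eq, Set.mem_empty_iff_false, iff_false, not_lt]
        simp
        positivity
      rw [this]; simp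
    · intro K hc hsym hK hp0 hpε
      exfalso
      have hne : K.Nonempty := by
        by_contra h
        rw [Set.not_nonempty_iff_eq_empty] at h
        simp [h] at hp0
      have : K = Set.univ := by
        obtain ⟨z, hz⟩ := hne
        ext x
        simp [Subsingleton.elim x z, hz]
      rw [this, measure_univ] at hpε
      simp at hpε
      linarith
  have hn' : (1:ℝ) ≤ n := by exact_mod_cast hn
  have hTn : 480000 * (n:ℝ) ≤ T * ε ^ 2 := by rwa [div_le_iff₀ (by positivity)] at hT
  have hT0 : (0:ℝ) < T := by
    by_contra h
    have : (T:ℝ) * ε ^ 2 ≤ 0 := mul_nonpos_of_nonpos_of_nonneg (not_lt.1 h) (by positivity)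
    linarith
  have hTn2 : 480000 ≤ T * (ε ^ 2 / n) := by
    rw [← mul_div_assoc, le_div_iff₀ (by linarith)]; exact hTn
  obtain ⟨q, hq⟩ : ∃ q, q = ε / (400 * n) := ⟨_, rfl⟩
  have hq0 : 0 < q := by rw [hq]; positivity
  have hqn : q * n = ε / 400 := by rw [hq]; field_simp
  have hqε : q * ε = (ε ^ 2 / n) / 400 := by rw [hq]; field_simp
  have hqhalf : q ≤ 1/2 := by nlinarith
  refine ⟨?_, ?_⟩
  · refine final_num (stdGaussian n) T (F := fun x => (-q) * ‖x‖ ^ 2 / 2) (by fun_prop)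
      (-(q / 2) * (T * (n - 1/50 * ε / 2))) (-(n / 2) * (q - q ^ 2 / 2)) ?_ ?_ ?_
    · intro x hx
      simp only [Set.mem_ofPred_eq] at hx
      rw [one_div, inv_mul_lt_iff₀ hT0] at hx
      have : ∑ i, (-q) * ‖x i‖ ^ 2 / 2 = -(q/2) * ∑ i, ‖x i‖ ^ 2 := by
        rw [Finset.mul_sum]; congr 1; ext i; ring
      rw [this]
      nlinarith
    · have h1 := mgf_eq n (q := -q) (by linarith) (K := Set.univ) MeasurableSet.univ
      rw [Measure.restrict_univ] at h1
      rw [h1]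
      calc _ ≤ ENNReal.ofReal ((1 - -q) ^ (-(n:ℝ)/2)) * 1 := by gcongr; exact prob_le_one
        _ ≤ _ := by
          rw [mul_one]
          apply ENNReal.ofReal_le_ofReal
          rw [rpow_def_of_pos (by linarith)]
          apply exp_le_exp.2
          have h2 : q - q ^ 2 / 2 ≤ log (1 - -q) := by
            have h3 := Real.le_log_one_add_of_nonneg hq0.le
            rw [sub_neg_eq_add]
            refine le_trans ?_ h3
            rw [le_div_iff₀ (by linarith)]
            nlinarith [pow_pos hq0 3]
          nlinarith
    · have h1 : -(-(q / 2) * (T * (n - 1/50 * ε / 2))) + T * (-(n / 2) * (q - q ^ 2 / 2))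
          = T * (-(q * ε) / 200 + q * (q * n) / 4) := by ring
      rw [h1, hqn]
      have h2 : (T:ℝ) * (-(q * ε) / 200 + q * (ε / 400) / 4) = - (T * (q * ε)) * (7/1600) := by ring
      rw [h2, hqε]
      nlinarith
  · intro K hc hsym hK hp0 hpε
    have hne0 : stdGaussian n K ≠ 0 := by intro h; simp [h] at hp0
    have hnet : stdGaussian n K ≠ ⊤ := measure_ne_top _ _
    have : IsFiniteMeasure (truncGaussian n K) := by
      unfold truncGaussian
      exact Measure.smul_finite _ (by simpa using hne0)
    refine final_num (truncGaussian n K) T (F := fun x => q * ‖x‖ ^ 2 / 2) (by fun_prop)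
      ((q / 2) * (T * (n - 1/50 * ε / 2))) ((n / 2) * (q + 2 * q ^ 2) - ε * q / 100) ?_ ?_ ?_
    · intro x hx
      simp only [Set.mem_ofPred_eq] at hx
      rw [one_div_mul_eq_div (T:ℝ), le_div_iff₀ hT0, mul_comm] at hx
      have : ∑ i, q * ‖x i‖ ^ 2 / 2 = (q/2) * ∑ i, ‖x i‖ ^ 2 := by
        rw [Finset.mul_sum]; congr 1; ext i; ring
      rw [this]
      gcongr
    · unfold truncGaussian
      rw [lintegral_smul_measure, smul_eq_mul]
      calc _ ≤ (stdGaussian n K)⁻¹ * (ENNReal.ofReal ((1 - q) ^ (-(n : ℝ) / 2) *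
              exp (-(ε * q / 100))) * stdGaussian n K) := by
            gcongr
            exact mgf_bound n hc hsym hK hε hε1 hp0 hpε hq0 (by linarith)
        _ = ENNReal.ofReal ((1 - q) ^ (-(n : ℝ) / 2) * exp (-(ε * q / 100))) := by
            rw [mul_comm, mul_assoc, ENNReal.mul_inv_cancel hne0 hnet, mul_one]
        _ ≤ _ := by
            apply ENNReal.ofReal_le_ofReal
            rw [rpow_def_of_pos (by linarith), ← exp_add]
            apply exp_le_exp.2
            have h3 := Real.one_sub_inv_le_log_of_pos (show 0 < 1 - q by linarith)
            have h4 : (1 - q)⁻¹ ≤ 1 + q + 2 * q ^ 2 := by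
              rw [inv_le_iff_one_le_mul₀ (by linarith)]
              nlinarith [pow_pos hq0 2]
            nlinarith
    · have h1 : -((q / 2) * (T * (n - 1/50 * ε / 2))) + T * ((n / 2) * (q + 2 * q ^ 2) - ε * q / 100)
          = T * (-(q * ε) / 200 + q * (q * n)) := by ring
      rw [h1, hqn]
      have h2 : (T:ℝ) * (-(q * ε) / 200 + q * (ε / 400)) = - (T * (q * ε)) / 400 := by ring
      rw [h2, hqε]
      nlinarith
end
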